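/- For each n, let G_n be a finite simple graph that is either a quasi-threshold graph or co-chromatic with some quasi-threshold graph. Let f(n) be the number of vertices of G_n and g(n) = χ(G_n)/f(n). If f(n) → ∞ and g(n) → 0 as n → ∞, then the graph Stirling sequence ({G_n brace k})_{k ∈ ℤ} is asymptotically normal. -/

import Mathlib

/-- Total mass of a sequence indexed by `ℤ`. -/
noncomputable def seqTotal (a : ℤ → ℝ) : ℝ := ∑ᶠ k, a k

/-- The probability mass function obtained by normalizing the sequence `a`. -/
noncomputable def seqPMF (a : ℤ → ℝ) (k : ℤ) : ℝ := a k / seqTotal a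

/-- The mean of the random variable `X` with `P(X = k) = a k / Σ_j a j`. -/
noncomputable def seqMean (a : ℤ → ℝ) : ℝ := ∑ᶠ k : ℤ, (k : ℝ) * seqPMF a k

/-- The standard deviation of the random variable `X` with `P(X = k) = a k / Σ_j a j`. -/
noncomputable def seqStdDev (a : ℤ → ℝ) : ℝ :=
  Real.sqrt (∑ᶠ k : ℤ, ((k : ℝ) - seqMean a) ^ 2 * seqPMF a k)

/-- `P((X - μ)/σ ≤ x)` for the random variable `X` with `P(X = k) = a k / Σ_j a j`. -/
noncomputable def seqNormalizedCDF (a : ℤ → ℝ) (x : ℝ) : ℝ :=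
  ∑ᶠ k ∈ {k : ℤ | ((k : ℝ) - seqMean a) / seqStdDev a ≤ x}, seqPMF a k

/-- The cumulative distribution function of the standard normal distribution. -/
noncomputable def stdNormalCDF (x : ℝ) : ℝ :=
  ∫ t in Set.Iio x, Real.exp (-(t ^ 2) / 2) / Real.sqrt (2 * Real.pi)

/-- A family of non-negative sequences `(a n k)_{k ∈ ℤ}` is asymptotically normal if the
normalized random variable `(X_n - μ_n)/σ_n` converges in distribution to a standard normal. -/
def AsymptoticallyNormal (a : ℕ → ℤ → ℝ) : Prop :=
  ∀ x : ℝ, Filter.Tendsto (fun n => seqNormalizedCDF (a n) x)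
    Filter.atTop (nhds (stdNormalCDF x))
/-- `graphStirling G k` is the number of partitions of the vertex set of `G` into `k`
non-empty independent sets. -/
noncomputable def graphStirling {V : Type*} (G : SimpleGraph V) (k : ℕ) : ℕ :=
  Nat.card {P : Finset (Finset V) // P.card = k ∧ (∀ p ∈ P, p.Nonempty) ∧
    (∀ v : V, ∃! p, p ∈ P ∧ v ∈ p) ∧ ∀ p ∈ P, ∀ u ∈ p, ∀ v ∈ p, ¬ G.Adj u v}
/-- `colorCount G q` is the number of proper colorings of `G` with `q` colors, i.e. the value
of the chromatic polynomial of `G` at `q`. -/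
noncomputable def colorCount {V : Type*} (G : SimpleGraph V) (q : ℕ) : ℕ :=
  Nat.card {c : V → Fin q // ∀ u v : V, G.Adj u v → c u ≠ c v}

/-- Two graphs are co-chromatic if they have the same chromatic polynomial, equivalently the
same number of proper `q`-colorings for every `q`. -/
def CoChromatic {V W : Type*} (G : SimpleGraph V) (H : SimpleGraph W) : Prop :=
  ∀ q : ℕ, colorCount G q = colorCount H q
/-- The graph obtained from `G` by adding a dominating vertex (a new vertex adjacent to all
the vertices of `G`). -/
def addDom {V : Type} (G : SimpleGraph V) : SimpleGraph (Option V) :=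
  SimpleGraph.fromRel (fun a b =>
    (∃ u v : V, a = some u ∧ b = some v ∧ G.Adj u v) ∨ a = none)

/-- The disjoint union of two graphs. -/
def disjUnion {V W : Type} (G : SimpleGraph V) (H : SimpleGraph W) : SimpleGraph (V ⊕ W) :=
  SimpleGraph.fromRel (fun a b =>
    (∃ u v : V, a = Sum.inl u ∧ b = Sum.inl v ∧ G.Adj u v) ∨
    (∃ u v : W, a = Sum.inr u ∧ b = Sum.inr v ∧ H.Adj u v))

/-- Quasi-threshold graphs: the smallest class of graphs (closed under isomorphism) containing
`K_1` and closed under adding a dominating vertex and under disjoint union. -/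
inductive IsQuasiThreshold : {V : Type} → SimpleGraph V → Prop where
  | single : IsQuasiThreshold (⊥ : SimpleGraph PUnit)
  | addDominating {V : Type} {G : SimpleGraph V} :
      IsQuasiThreshold G → IsQuasiThreshold (addDom G)
  | union {V W : Type} {G : SimpleGraph V} {H : SimpleGraph W} :
      IsQuasiThreshold G → IsQuasiThreshold H → IsQuasiThreshold (disjUnion G H)
  | iso {V W : Type} {G : SimpleGraph V} {H : SimpleGraph W} :
      IsQuasiThreshold G → G ≃g H → IsQuasiThreshold H

open Polynomial in
theorem Polynomial.eval_one_prod_X_add_C_pos (R : Multiset ℝ) (hR : ∀ r ∈ R, 0 ≤ r) :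
    0 < ((R.map fun r => X + C r).prod).eval 1 := by
  induction R using Multiset.induction_on with
  | empty => simp
  | cons a R ih =>
    have := ih fun r hr => hR r (Multiset.mem_cons_of_mem hr)
    have ha := hR a (Multiset.mem_cons_self _ _)
    simp only [Multiset.map_cons, Multiset.prod_cons, eval_mul, eval_add, eval_X, eval_C]
    positivity

open Polynomial in
theorem Polynomial.derivative_eval_one_prod_X_add_C (R : Multiset ℝ) (hR : ∀ r ∈ R, 0 ≤ r) :
    (derivative (R.map fun r => X + C r).prod).eval 1 =
      ((R.map fun r => X + C r).prod).eval 1 * (R.map fun r => 1 / (1 + r)).sum := by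
  induction R using Multiset.induction_on with
  | empty => simp
  | cons a R ih =>
    have ih := ih fun r hr => hR r (Multiset.mem_cons_of_mem hr)
    have ha := hR a (Multiset.mem_cons_self _ _)
    have : (1 + a) ≠ 0 := by positivity
    simp only [Multiset.map_cons, Multiset.prod_cons, eval_mul, eval_add, eval_X, eval_C,
      derivative_mul, derivative_add, derivative_X, derivative_C, ih, Multiset.sum_cons, eval_one,
      eval_zero]
    field_simp
    ring

open Polynomial in
theorem Polynomial.derivative_derivative_eval_one_prod_X_add_C (R : Multiset ℝ)
    (hR : ∀ r ∈ R, 0 ≤ r) :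
    (derivative (derivative (R.map fun r => X + C r).prod)).eval 1 =
      ((R.map fun r => X + C r).prod).eval 1 * ((R.map fun r => 1 / (1 + r)).sum ^ 2 +
        (R.map fun r => 1 / (1 + r) * (1 - 1 / (1 + r))).sum - (R.map fun r => 1 / (1 + r)).sum) := by
  induction R using Multiset.induction_on with
  | empty => simp
  | cons a R ih =>
    have hR' : ∀ r ∈ R, 0 ≤ r := fun r hr => hR r (Multiset.mem_cons_of_mem hr)
    have ih := ih hR'
    have h1 := Polynomial.derivative_eval_one_prod_X_add_C R hR'
    have ha := hR a (Multiset.mem_cons_self _ _)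
    have : (1 + a) ≠ 0 := by positivity
    simp only [Multiset.map_cons, Multiset.prod_cons, eval_mul, eval_add, eval_X, eval_C,
      derivative_mul, derivative_add, derivative_X, derivative_C, ih, h1, Multiset.sum_cons,
      eval_one, eval_zero, derivative_one, derivative_zero]
    field_simp
    ring

open Polynomial in
/-- The coefficients of a real polynomial, as a sequence indexed by `ℤ`. -/
noncomputable def coeffSeq (F : ℝ[X]) (k : ℤ) : ℝ := if 0 ≤ k then F.coeff k.toNat else 0

open Polynomial in
theorem finsum_mul_coeffSeq (F : ℝ[X]) (φ : ℤ → ℝ) :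
    ∑ᶠ k, φ k * coeffSeq F k = ∑ i ∈ Finset.range (F.natDegree + 1), φ i * F.coeff i := by
  rw [finsum_eq_sum_of_support_subset (s := (Finset.range (F.natDegree + 1)).map Nat.castEmbedding)]
  · simp [coeffSeq]
  · intro k hk
    have hk' : coeffSeq F k ≠ 0 := right_ne_zero_of_mul hk
    unfold coeffSeq at hk'
    have h0 : 0 ≤ k := by
      by_contra h
      simp [h] at hk'
    rw [if_pos h0] at hk'
    have := Polynomial.le_natDegree_of_ne_zero hk'
    simp only [Finset.coe_map, Set.mem_image, Finset.mem_coe, Finset.mem_range]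
    exact ⟨k.toNat, by omega, by simp [h0]⟩

open Polynomial in
theorem seqTotal_coeffSeq (F : ℝ[X]) : seqTotal (coeffSeq F) = F.eval 1 := by
  have := finsum_mul_coeffSeq F fun _ => 1
  simp only [one_mul] at this
  rw [seqTotal, this, eval_eq_sum_range]
  simp

open Polynomial in
theorem finsum_mul_seqPMF_coeffSeq (F : ℝ[X]) (φ : ℤ → ℝ) :
    ∑ᶠ k, φ k * seqPMF (coeffSeq F) k =
      (∑ i ∈ Finset.range (F.natDegree + 1), φ i * F.coeff i) / F.eval 1 := by
  have := finsum_mul_coeffSeq F fun k => φ k / F.eval 1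
  rw [Finset.sum_div]
  convert this using 3
  · rw [seqPMF, seqTotal_coeffSeq]; ring
  · ring

open Polynomial in
theorem Polynomial.sum_natCast_mul_coeff (F : ℝ[X]) :
    ∑ i ∈ Finset.range (F.natDegree + 1), (i : ℝ) * F.coeff i = (derivative F).eval 1 := by
  rw [derivative_eval, sum_over_range _ (by simp)]
  exact Finset.sum_congr rfl fun i _ => by simp [mul_comm]

open Polynomial in
theorem Polynomial.sum_natCast_sq_mul_coeff (F : ℝ[X]) :
    ∑ i ∈ Finset.range (F.natDegree + 1), (i : ℝ) ^ 2 * F.coeff i =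
      (derivative (derivative F)).eval 1 + (derivative F).eval 1 := by
  have h : (derivative (X * derivative F)).eval 1 =
      (derivative (derivative F)).eval 1 + (derivative F).eval 1 := by
    simp [derivative_mul, add_comm]
  rw [← h, ← sum_natCast_mul_coeff]
  by_cases hF : F.natDegree = 0
  · rw [eq_C_of_natDegree_eq_zero hF]; simp
  have hle : (X * derivative F).natDegree ≤ F.natDegree := by
    have h1 := natDegree_derivative_lt hF
    have h2 := natDegree_mul_le (p := X) (q := derivative F)
    have h3 := natDegree_X_le (R := ℝ)
    omega
  rw [Finset.sum_subset (Finset.range_mono (Nat.succ_le_succ hle))]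
  · refine Finset.sum_congr rfl fun i _ => ?_
    cases i with
    | zero => simp
    | succ i => rw [coeff_X_mul, coeff_derivative]; push_cast; ring
  · intro i _ hi
    rw [coeff_eq_zero_of_natDegree_lt (by simpa using hi), mul_zero]

open Polynomial in
theorem seqMean_coeffSeq (F : ℝ[X]) :
    seqMean (coeffSeq F) = (derivative F).eval 1 / F.eval 1 := by
  have := finsum_mul_seqPMF_coeffSeq F fun k => (k : ℝ)
  rw [seqMean, this]
  congr 1
  simpa using sum_natCast_mul_coeff F

open Polynomial in
theorem seqStdDev_coeffSeq (F : ℝ[X]) : seqStdDev (coeffSeq F) = √((∑ i ∈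
    Finset.range (F.natDegree + 1), ((i : ℝ) - seqMean (coeffSeq F)) ^ 2 * F.coeff i) / F.eval 1) := by
  have := finsum_mul_seqPMF_coeffSeq F fun k => ((k : ℝ) - seqMean (coeffSeq F)) ^ 2
  rw [seqStdDev, this]
  simp

open Polynomial in
theorem seqMean_coeffSeq_prod (R : Multiset ℝ) (hR : ∀ r ∈ R, 0 ≤ r) :
    seqMean (coeffSeq (R.map fun r => X + C r).prod) = (R.map fun r => 1 / (1 + r)).sum := by
  rw [seqMean_coeffSeq, derivative_eval_one_prod_X_add_C R hR,
    mul_div_cancel_left₀ _ (eval_one_prod_X_add_C_pos R hR).ne']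

open Polynomial in
theorem variance_coeffSeq_prod (R : Multiset ℝ) (hR : ∀ r ∈ R, 0 ≤ r) :
    (∑ i ∈ Finset.range ((R.map fun r => X + C r).prod.natDegree + 1),
      ((i : ℝ) - seqMean (coeffSeq (R.map fun r => X + C r).prod)) ^ 2 *
        (R.map fun r => X + C r).prod.coeff i) / (R.map fun r => X + C r).prod.eval 1 =
      (R.map fun r => 1 / (1 + r) * (1 - 1 / (1 + r))).sum := by
  have h0 := eval_one_prod_X_add_C_pos R hR
  have h1 := derivative_eval_one_prod_X_add_C R hR
  have h2 := derivative_derivative_eval_one_prod_X_add_C R hR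
  rw [seqMean_coeffSeq_prod R hR]
  generalize (R.map fun r => X + C r).prod = F at *
  generalize (R.map fun r => 1 / (1 + r)).sum = μ at *
  have e0 : ∑ i ∈ Finset.range (F.natDegree + 1), F.coeff i = F.eval 1 := by
    rw [eval_eq_sum_range]; simp
  have e1 := sum_natCast_mul_coeff F
  have e2 := sum_natCast_sq_mul_coeff F
  have : ∀ i : ℕ, ((i : ℝ) - μ) ^ 2 * F.coeff i =
      (i : ℝ) ^ 2 * F.coeff i - 2 * μ * (i * F.coeff i) + μ ^ 2 * F.coeff i := fun i => by ring
  simp only [this, Finset.sum_add_distrib, Finset.sum_sub_distrib, ← Finset.mul_sum, e0, e1, e2, h1,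
    h2]
  field_simp
  ring

theorem Complex.norm_exp_ofReal_mul_I_sub_le {x : ℝ} (hx : |x| ≤ 1) :
    ‖Complex.exp (x * Complex.I) - (1 + x * Complex.I - x ^ 2 / 2)‖ ≤ |x| ^ 3 := by
  have hn : ‖(x * Complex.I : ℂ)‖ = |x| := by simp
  have h := Complex.exp_bound (x := x * Complex.I) (by rwa [hn]) (n := 3) (by norm_num)
  rw [hn] at h
  simp only [Finset.sum_range_succ, Finset.sum_range_zero, Nat.factorial] at h
  have he : (1 + x * Complex.I - x ^ 2 / 2 : ℂ) = 0 + (x * Complex.I) ^ 0 / (1 : ℕ) +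
      (x * Complex.I) ^ 1 / ((0 + 1) * 1 : ℕ) +
        (x * Complex.I) ^ 2 / ((1 + 1) * ((0 + 1) * 1) : ℕ) := by
    rw [mul_pow _ _ 2, Complex.I_sq]; push_cast; ring
  rw [he]
  refine h.trans ?_
  have : 0 ≤ |x| ^ 3 := by positivity
  norm_num
  linarith

/-- The characteristic function of a centred Bernoulli variable of parameter `p`. -/
noncomputable def centeredBernoulliCharFun (s p : ℝ) : ℂ :=
  (1 - p) * Complex.exp ((-(s * p) : ℝ) * Complex.I) +
    p * Complex.exp ((s * (1 - p) : ℝ) * Complex.I)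

theorem norm_centeredBernoulliCharFun_le {p : ℝ} (hp0 : 0 ≤ p) (hp1 : p ≤ 1) (s : ℝ) :
    ‖centeredBernoulliCharFun s p‖ ≤ 1 := by
  refine (norm_add_le _ _).trans ?_
  rw [norm_mul, norm_mul, Complex.norm_exp_ofReal_mul_I, Complex.norm_exp_ofReal_mul_I]
  have h1 : ‖(1 - p : ℂ)‖ = 1 - p := by
    rw [← Complex.ofReal_one, ← Complex.ofReal_sub, Complex.norm_real, Real.norm_of_nonneg]
    linarith
  rw [h1, Complex.norm_real, Real.norm_of_nonneg hp0]
  linarith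

theorem norm_centeredBernoulliCharFun_sub_exp_le {p : ℝ} (hp0 : 0 ≤ p) (hp1 : p ≤ 1) {s : ℝ}
    (hs : |s| ≤ 1) :
    ‖centeredBernoulliCharFun s p - (Real.exp (-(p * (1 - p) * (s ^ 2 / 2))) : ℝ)‖ ≤
      p * (1 - p) * (2 * |s| ^ 3) := by
  have hq : 0 ≤ 1 - p := by linarith
  have hs0 := abs_nonneg s
  have a1 : |-(s * p)| = |s| * p := by rw [abs_neg, abs_mul, abs_of_nonneg hp0]
  have a2 : |s * (1 - p)| = |s| * (1 - p) := by rw [abs_mul, abs_of_nonneg hq]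
  have h1 := Complex.norm_exp_ofReal_mul_I_sub_le (x := -(s * p)) (by rw [a1]; nlinarith)
  have h2 := Complex.norm_exp_ofReal_mul_I_sub_le (x := s * (1 - p)) (by rw [a2]; nlinarith)
  rw [a1] at h1
  rw [a2] at h2
  have hpq : p * (1 - p) ≤ 1 := by nlinarith
  have hpq0 : 0 ≤ p * (1 - p) := by positivity
  have hs2 : s ^ 2 ≤ 1 := by rw [← sq_abs]; nlinarith
  have hy0 : 0 ≤ p * (1 - p) * (s ^ 2 / 2) := by positivity
  have hy1 : p * (1 - p) * (s ^ 2 / 2) ≤ 1 := by nlinarith [sq_nonneg s]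
  have h3 := Real.abs_exp_sub_one_sub_id_le (x := -(p * (1 - p) * (s ^ 2 / 2)))
    (by rw [abs_neg, abs_of_nonneg hy0]; exact hy1)
  set y := -(p * (1 - p) * (s ^ 2 / 2)) with hy
  have key : centeredBernoulliCharFun s p - (Real.exp y : ℝ) =
      ((1 - p : ℝ) : ℂ) * (Complex.exp ((-(s * p) : ℝ) * Complex.I) -
        (1 + (-(s * p) : ℝ) * Complex.I - ((-(s * p) : ℝ) : ℂ) ^ 2 / 2)) +
      (p : ℂ) * (Complex.exp ((s * (1 - p) : ℝ) * Complex.I) -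
        (1 + (s * (1 - p) : ℝ) * Complex.I - ((s * (1 - p) : ℝ) : ℂ) ^ 2 / 2)) -
      ((Real.exp y - 1 - y : ℝ) : ℂ) := by
    rw [centeredBernoulliCharFun, hy]
    push_cast
    ring
  rw [key]
  refine (norm_sub_le _ _).trans ((add_le_add_left (norm_add_le _ _) _).trans ?_)
  rw [norm_mul, norm_mul, Complex.norm_real, Complex.norm_real, Complex.norm_real,
    Real.norm_of_nonneg hp0, Real.norm_of_nonneg hq, Real.norm_eq_abs]
  have e1 := mul_le_mul_of_nonneg_left h1 hq
  have e2 := mul_le_mul_of_nonneg_left h2 hp0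
  have e3 : y ^ 2 ≤ p * (1 - p) * |s| ^ 3 := by
    have : y ^ 2 = (p * (1 - p) * |s| ^ 3) * (p * (1 - p) * |s| / 4) := by
      rw [hy, ← sq_abs s]; ring
    rw [this]
    refine mul_le_of_le_one_right (by positivity) ?_
    nlinarith
  have e4 : (1 - p) * (|s| * p) ^ 3 + p * (|s| * (1 - p)) ^ 3 ≤ p * (1 - p) * |s| ^ 3 := by
    have : (1 - p) * (|s| * p) ^ 3 + p * (|s| * (1 - p)) ^ 3 =
      (p * (1 - p) * |s| ^ 3) * (p ^ 2 + (1 - p) ^ 2) := by ring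
    rw [this]
    refine mul_le_of_le_one_right (by positivity) ?_
    nlinarith
  linarith

theorem Multiset.norm_prod_map_le_one {α : Type*} (s : Multiset α) (b : α → ℂ)
    (hb : ∀ x ∈ s, ‖b x‖ ≤ 1) : ‖(s.map b).prod‖ ≤ 1 := by
  induction s using Multiset.induction_on with
  | empty => simp
  | cons x s ih =>
    rw [map_cons, prod_cons, norm_mul]
    exact mul_le_one₀ (hb x (mem_cons_self _ _)) (norm_nonneg _)
      (ih fun y hy => hb y (mem_cons_of_mem hy))

theorem Multiset.norm_prod_map_sub_prod_map_le {α : Type*} (s : Multiset α) (a b : α → ℂ)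
    (c : α → ℝ) (ha : ∀ x ∈ s, ‖a x‖ ≤ 1) (hb : ∀ x ∈ s, ‖b x‖ ≤ 1)
    (hc : ∀ x ∈ s, ‖a x - b x‖ ≤ c x) :
    ‖(s.map a).prod - (s.map b).prod‖ ≤ (s.map c).sum := by
  induction s using Multiset.induction_on with
  | empty => simp
  | cons x s ih =>
    have ih := ih (fun y hy => ha y (mem_cons_of_mem hy)) (fun y hy => hb y (mem_cons_of_mem hy))
      (fun y hy => hc y (mem_cons_of_mem hy))
    have hb' := norm_prod_map_le_one s b fun y hy => hb y (mem_cons_of_mem hy)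
    simp only [map_cons, prod_cons, sum_cons]
    have : a x * (s.map a).prod - b x * (s.map b).prod =
      (a x - b x) * (s.map b).prod + a x * ((s.map a).prod - (s.map b).prod) := by ring
    rw [this]
    refine (norm_add_le _ _).trans (add_le_add ?_ ?_)
    · rw [norm_mul]
      exact (mul_le_of_le_one_right (norm_nonneg _) hb').trans (hc x (mem_cons_self _ _))
    · rw [norm_mul]
      exact (mul_le_of_le_one_left (norm_nonneg _) (ha x (mem_cons_self _ _))).trans ih

open Filter in
theorem tendsto_prod_centeredBernoulliCharFun (P : ℕ → Multiset ℝ)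
    (hP : ∀ n, ∀ p ∈ P n, 0 ≤ p ∧ p ≤ 1)
    (hv : Tendsto (fun n => ((P n).map fun p => p * (1 - p)).sum) atTop atTop) (t : ℝ) :
    Tendsto (fun n => ((P n).map
        (centeredBernoulliCharFun (t / √((P n).map fun p => p * (1 - p)).sum))).prod)
      atTop (nhds (Complex.exp (-t ^ 2 / 2))) := by
  set v : ℕ → ℝ := fun n => ((P n).map fun p => p * (1 - p)).sum with hvdef
  have hsq : Tendsto (fun n => √(v n)) atTop atTop := Real.tendsto_sqrt_atTop.comp hv
  have hbound : ∀ᶠ n in atTop, ‖((P n).map (centeredBernoulliCharFun (t / √(v n)))).prod -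
      Complex.exp (-t ^ 2 / 2)‖ ≤ 2 * |t| ^ 3 * (√(v n))⁻¹ := by
    filter_upwards [hsq.eventually_ge_atTop (max |t| 1)] with n hn
    have hσ1 : 1 ≤ √(v n) := (le_max_right _ _).trans hn
    have hσ : 0 < √(v n) := by linarith
    have hσ2 : √(v n) ^ 2 = v n := by
      apply Real.sq_sqrt
      by_contra h
      rw [Real.sqrt_eq_zero_of_nonpos (by linarith)] at hσ
      exact lt_irrefl _ hσ
    have hs : |t / √(v n)| ≤ 1 := by
      rw [abs_div, abs_of_pos hσ, div_le_one hσ]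
      exact (le_max_left _ _).trans hn
    have hexp : ((P n).map fun p => ((Real.exp
        (-(p * (1 - p) * ((t / √(v n)) ^ 2 / 2))) : ℝ) : ℂ)).prod = Complex.exp (-t ^ 2 / 2) := by
      have h1 : ∀ (s : Multiset ℝ) (f : ℝ → ℝ),
          (s.map fun p => ((Real.exp (-(f p)) : ℝ) : ℂ)).prod = (Real.exp (-(s.map f).sum) : ℝ) := by
        intro s f
        induction s using Multiset.induction_on with
        | empty => simp
        | cons a s ih =>
          rw [Multiset.map_cons, Multiset.prod_cons, ih, Multiset.map_cons, Multiset.sum_cons,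
            neg_add, Real.exp_add, Complex.ofReal_mul]
      rw [h1, Multiset.sum_map_mul_right]
      have : v n * ((t / √(v n)) ^ 2 / 2) = t ^ 2 / 2 := by
        rw [div_pow, hσ2]
        have : v n ≠ 0 := by rw [← hσ2]; positivity
        field_simp
      simp only [hvdef] at this ⊢
      rw [this]
      push_cast
      ring_nf
    rw [← hexp]
    refine (Multiset.norm_prod_map_sub_prod_map_le _ _ _ _
      (fun p hp => norm_centeredBernoulliCharFun_le (hP n p hp).1 (hP n p hp).2 _)
      (fun p hp => ?_) (fun p hp => norm_centeredBernoulliCharFun_sub_exp_le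
        (hP n p hp).1 (hP n p hp).2 hs)).trans ?_
    · rw [Complex.norm_real, Real.norm_of_nonneg (Real.exp_pos _).le, Real.exp_le_one_iff]
      have h1 := (hP n p hp).1
      have h2 : 0 ≤ 1 - p := by linarith [(hP n p hp).2]
      have : 0 ≤ p * (1 - p) * ((t / √(v n)) ^ 2 / 2) := by positivity
      linarith
    · rw [Multiset.sum_map_mul_right]
      change v n * _ ≤ _
      rw [abs_div, abs_of_pos hσ, div_pow]
      have : v n * (2 * (|t| ^ 3 / √(v n) ^ 3)) = √(v n) ^ 2 * (2 * (|t| ^ 3 / √(v n) ^ 3)) := by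
        rw [hσ2]
      rw [this]
      apply le_of_eq
      field_simp
  rw [tendsto_iff_norm_sub_tendsto_zero]
  refine squeeze_zero' (Eventually.of_forall fun _ => norm_nonneg _) hbound ?_
  simpa using (tendsto_inv_atTop_zero.comp hsq).const_mul (2 * |t| ^ 3)

open Polynomial MeasureTheory in
/-- The law of `(X - m) / σ` where `P(X = k)` is proportional to the `k`th coefficient of `F`. -/
noncomputable def coeffLaw (F : ℝ[X]) (m σ : ℝ) : Measure ℝ :=
  ∑ i ∈ Finset.range (F.natDegree + 1),
    ENNReal.ofReal (F.coeff i / F.eval 1) • Measure.dirac (((i : ℝ) - m) / σ)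

open Polynomial MeasureTheory in
theorem coeffLaw_apply (F : ℝ[X]) (m σ : ℝ) (hF : ∀ i, 0 ≤ F.coeff i) (h1 : 0 < F.eval 1)
    {s : Set ℝ} (hs : MeasurableSet s) : coeffLaw F m σ s = ENNReal.ofReal
      (∑ i ∈ Finset.range (F.natDegree + 1),
        s.indicator (fun _ => F.coeff i / F.eval 1) (((i : ℝ) - m) / σ)) := by
  rw [coeffLaw, Measure.finsetSum_apply, ENNReal.ofReal_sum_of_nonneg]
  · refine Finset.sum_congr rfl fun i _ => ?_
    rw [Measure.smul_apply, Measure.dirac_apply' _ hs]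
    by_cases h : ((i : ℝ) - m) / σ ∈ s <;> simp [h]
  · intro i _
    exact Set.indicator_nonneg (fun _ _ => div_nonneg (hF i) h1.le) _

open Polynomial MeasureTheory in
theorem isProbabilityMeasure_coeffLaw (F : ℝ[X]) (m σ : ℝ) (hF : ∀ i, 0 ≤ F.coeff i)
    (h1 : 0 < F.eval 1) : IsProbabilityMeasure (coeffLaw F m σ) := by
  constructor
  rw [coeffLaw_apply F m σ hF h1 MeasurableSet.univ]
  simp only [Set.indicator_univ]
  rw [← Finset.sum_div]
  have : ∑ i ∈ Finset.range (F.natDegree + 1), F.coeff i = F.eval 1 := by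
    rw [eval_eq_sum_range]; simp
  rw [this, div_self h1.ne', ENNReal.ofReal_one]

open Polynomial MeasureTheory in
theorem charFun_coeffLaw (F : ℝ[X]) (m σ : ℝ) (hF : ∀ i, 0 ≤ F.coeff i) (h1 : 0 < F.eval 1)
    (t : ℝ) : charFun (coeffLaw F m σ) t = Complex.exp ((-(t / σ * m) : ℝ) * Complex.I) *
      (aeval (Complex.exp ((t / σ : ℝ) * Complex.I)) F / (F.eval 1 : ℝ)) := by
  rw [charFun_apply_real, coeffLaw, integral_finsetSum_measure]
  · rw [aeval_eq_sum_range, Finset.sum_div, Finset.mul_sum]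
    refine Finset.sum_congr rfl fun i _ => ?_
    rw [integral_smul_measure, integral_dirac,
      ENNReal.toReal_ofReal (div_nonneg (hF i) h1.le)]
    rw [← Complex.exp_nat_mul, Complex.real_smul, Complex.real_smul]
    have : Complex.exp (t * (((i : ℝ) - m) / σ : ℝ) * Complex.I) =
        Complex.exp ((-(t / σ * m) : ℝ) * Complex.I) *
          Complex.exp (i * ((t / σ : ℝ) * Complex.I)) := by
      rw [← Complex.exp_add]
      congr 1
      push_cast
      ring
    rw [this]
    push_cast
    ring
  · intro i _
    exact Integrable.smul_measure (integrable_dirac (by simp)) ENNReal.ofReal_ne_top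

open Polynomial in
theorem coeff_prod_X_add_C_nonneg (R : Multiset ℝ) (hR : ∀ r ∈ R, 0 ≤ r) (i : ℕ) :
    0 ≤ ((R.map fun r => X + C r).prod).coeff i := by
  induction R using Multiset.induction_on generalizing i with
  | empty => simp only [Multiset.map_zero, Multiset.prod_zero, coeff_one]; split_ifs <;> simp
  | cons a R ih =>
    have ih := ih fun r hr => hR r (Multiset.mem_cons_of_mem hr)
    have ha := hR a (Multiset.mem_cons_self _ _)
    simp only [Multiset.map_cons, Multiset.prod_cons, add_mul, coeff_add, coeff_C_mul]
    refine add_nonneg ?_ (mul_nonneg ha (ih i))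
    cases i with
    | zero => simp
    | succ i => rw [coeff_X_mul]; exact ih i

open Polynomial in
theorem exp_mul_aeval_prod_X_add_C_div (R : Multiset ℝ) (hR : ∀ r ∈ R, 0 ≤ r) (s : ℝ) :
    Complex.exp ((-(s * (R.map fun r => 1 / (1 + r)).sum) : ℝ) * Complex.I) *
      (aeval (Complex.exp (s * Complex.I)) (R.map fun r => X + C r).prod /
        ((R.map fun r => X + C r).prod.eval 1 : ℝ)) =
      ((R.map fun r => 1 / (1 + r)).map (centeredBernoulliCharFun s)).prod := by
  induction R using Multiset.induction_on with
  | empty => simp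
  | cons a R ih =>
    rw [Multiset.map_cons, Multiset.map_cons, Multiset.map_cons, Multiset.prod_cons,
      Multiset.prod_cons, Multiset.sum_cons, ← ih fun r hr => hR r (Multiset.mem_cons_of_mem hr)]
    have ha := hR a (Multiset.mem_cons_self _ _)
    have h1 : (1 + a : ℂ) ≠ 0 := by
      rw [← Complex.ofReal_one, ← Complex.ofReal_add, Complex.ofReal_ne_zero]; positivity
    have e1 : ((-(s * (1 / (1 + a) + (R.map fun r => 1 / (1 + r)).sum)) : ℝ) * Complex.I : ℂ) =
      (-(s * (1 / (1 + a))) : ℝ) * Complex.I +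
        (-(s * (R.map fun r => 1 / (1 + r)).sum) : ℝ) * Complex.I := by push_cast; ring
    have e2 : ((s * (1 - 1 / (1 + a)) : ℝ) * Complex.I : ℂ) =
      (-(s * (1 / (1 + a))) : ℝ) * Complex.I + s * Complex.I := by push_cast; ring
    rw [centeredBernoulliCharFun, e1, e2, Complex.exp_add, Complex.exp_add]
    simp only [map_mul, map_add, aeval_X, aeval_C, eval_mul, eval_add, eval_X, eval_C]
    simp only [Complex.coe_algebraMap]
    push_cast
    rw [mul_div_mul_comm]
    have e3 : (1 - 1 / (1 + a) : ℂ) = a / (1 + a) := by field_simp; ring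
    rw [e3]
    ring

open ProbabilityTheory in
theorem gaussianReal_Iic_toReal (x : ℝ) :
    (gaussianReal 0 1 (Set.Iic x)).toReal = stdNormalCDF x := by
  rw [gaussianReal_apply_eq_integral _ one_ne_zero, ENNReal.toReal_ofReal, stdNormalCDF,
    ← MeasureTheory.integral_Iic_eq_integral_Iio]
  · refine MeasureTheory.integral_congr_ae (Filter.Eventually.of_forall fun t => ?_)
    simp [gaussianPDFReal_def, div_eq_inv_mul]
  · exact MeasureTheory.integral_nonneg fun t => gaussianPDFReal_nonneg _ _ _

open Polynomial in
theorem coeffLaw_Iic_toReal (F : ℝ[X]) (hF : ∀ i, 0 ≤ F.coeff i) (h1 : 0 < F.eval 1) (x : ℝ) :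
    (coeffLaw F (seqMean (coeffSeq F)) (seqStdDev (coeffSeq F)) (Set.Iic x)).toReal =
      seqNormalizedCDF (coeffSeq F) x := by
  rw [coeffLaw_apply _ _ _ hF h1 measurableSet_Iic, ENNReal.toReal_ofReal, seqNormalizedCDF]
  · rw [finsum_mem_def]
    have := finsum_mul_seqPMF_coeffSeq F ({k : ℤ | ((k : ℝ) - seqMean (coeffSeq F)) /
      seqStdDev (coeffSeq F) ≤ x}.indicator fun _ => 1)
    simp only [← Set.indicator_mul_left, one_mul] at this
    rw [this, Finset.sum_div]
    refine Finset.sum_congr rfl fun i _ => ?_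
    by_cases h : ((i : ℝ) - seqMean (coeffSeq F)) / seqStdDev (coeffSeq F) ≤ x <;> simp [h]
  · exact Finset.sum_nonneg fun i _ =>
      Set.indicator_nonneg (fun _ _ => div_nonneg (hF i) h1.le) _

open Polynomial Filter MeasureTheory ProbabilityTheory in
/-- Central limit theorem for the coefficients of polynomials with only nonpositive real roots. -/
theorem asymptoticallyNormal_coeffSeq_prod (R : ℕ → Multiset ℝ) (hR : ∀ n, ∀ r ∈ R n, 0 ≤ r)
    (hv : Tendsto (fun n => ((R n).map fun r => 1 / (1 + r) * (1 - 1 / (1 + r))).sum)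
      atTop atTop) :
    AsymptoticallyNormal fun n => coeffSeq ((R n).map fun r => X + C r).prod := by
  intro x
  set F : ℕ → ℝ[X] := fun n => ((R n).map fun r => X + C r).prod with hF
  have hF0 : ∀ n i, 0 ≤ (F n).coeff i := fun n i => coeff_prod_X_add_C_nonneg _ (hR n) i
  have hF1 : ∀ n, 0 < (F n).eval 1 := fun n => eval_one_prod_X_add_C_pos _ (hR n)
  let ν : ℕ → ProbabilityMeasure ℝ := fun n =>
    ⟨coeffLaw (F n) (seqMean (coeffSeq (F n))) (seqStdDev (coeffSeq (F n))),
      isProbabilityMeasure_coeffLaw _ _ _ (hF0 n) (hF1 n)⟩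
  let γ : ProbabilityMeasure ℝ := ⟨gaussianReal 0 1, inferInstance⟩
  have hσ : ∀ n, seqStdDev (coeffSeq (F n)) =
      √(((R n).map fun r => 1 / (1 + r)).map fun p => p * (1 - p)).sum := fun n => by
    rw [seqStdDev_coeffSeq, variance_coeffSeq_prod _ (hR n), Multiset.map_map]
    rfl
  have hlim : Tendsto ν atTop (nhds γ) := by
    refine ProbabilityMeasure.tendsto_of_tendsto_charFun fun t => ?_
    have h1 : charFun (γ : Measure ℝ) t = Complex.exp (-t ^ 2 / 2) := by
      change charFun (gaussianReal 0 1) t = _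
      rw [charFun_gaussianReal]
      congr 1
      push_cast
      ring
    rw [h1]
    have h2 := tendsto_prod_centeredBernoulliCharFun (fun n => (R n).map fun r => 1 / (1 + r))
      (fun n p hp => by
        obtain ⟨r, hr, rfl⟩ := Multiset.mem_map.1 hp
        have := hR n r hr
        exact ⟨by positivity, by rw [div_le_one (by positivity)]; linarith⟩)
      (by simpa only [Multiset.map_map, Function.comp_def] using hv) t
    refine h2.congr fun n => ?_
    change _ = charFun (coeffLaw (F n) (seqMean (coeffSeq (F n))) (seqStdDev (coeffSeq (F n)))) t
    rw [charFun_coeffLaw _ _ _ (hF0 n) (hF1 n), seqMean_coeffSeq_prod _ (hR n),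
      exp_mul_aeval_prod_X_add_C_div _ (hR n), hσ]
  have h3 := ProbabilityMeasure.tendsto_measure_of_null_frontier_of_tendsto' hlim
    (E := Set.Iic x) (by
      rw [frontier_Iic]
      change gaussianReal 0 1 {x} = 0
      have := nullSingletonClass_gaussianReal (μ := 0) (v := 1) one_ne_zero
      exact measure_singleton x)
  have h4 := (ENNReal.tendsto_toReal (measure_ne_top _ _)).comp h3
  have h5 : ((γ : Measure ℝ) (Set.Iic x)).toReal = stdNormalCDF x := gaussianReal_Iic_toReal x
  rw [h5] at h4
  exact h4.congr fun n => coeffLaw_Iic_toReal (F n) (hF0 n) (hF1 n) x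

theorem mul_one_sub_le_sum_sq_sub_mul (s : Finset ℕ) (q : ℕ → ℝ) (δ μ : ℝ) (hq : ∀ i, 0 ≤ q i)
    (hδ : ∀ i, q i ≤ δ) (hs : ∑ i ∈ s, q i = 1) (T : ℕ) :
    (T : ℝ) ^ 2 * (1 - (2 * T + 1) * δ) ≤ ∑ i ∈ s, ((i : ℝ) - μ) ^ 2 * q i := by
  set A := s.filter fun i : ℕ => |(i : ℝ) - μ| < T with hA
  have hsub : A ⊆ Finset.Icc ⌊μ - T⌋₊ (⌊μ - T⌋₊ + 2 * T) := by
    intro i hi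
    have hi' := abs_lt.1 (Finset.mem_filter.1 hi).2
    have h1 : μ - T < ⌊μ - T⌋₊ + 1 := Nat.lt_floor_add_one _
    rw [Finset.mem_Icc]
    constructor
    · exact Nat.floor_le_of_le (by linarith)
    · have : (i : ℝ) < (⌊μ - T⌋₊ + 2 * T + 1 : ℕ) := by push_cast; linarith
      exact Nat.lt_succ_iff.1 (by exact_mod_cast this)
  have hδ0 : 0 ≤ δ := (hq 0).trans (hδ 0)
  have hcard : (A.card : ℝ) ≤ 2 * T + 1 := by
    have h := Finset.card_le_card hsub
    rw [Nat.card_Icc] at h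
    have : A.card ≤ 2 * T + 1 := by omega
    exact_mod_cast this
  have hAq : ∑ i ∈ A, q i ≤ (2 * T + 1) * δ := by
    refine (Finset.sum_le_card_nsmul _ _ δ fun i _ => hδ i).trans ?_
    rw [nsmul_eq_mul]
    exact mul_le_mul_of_nonneg_right hcard hδ0
  have hsplit := Finset.sum_filter_add_sum_filter_not s (fun i : ℕ => |(i : ℝ) - μ| < T) q
  calc (T : ℝ) ^ 2 * (1 - (2 * T + 1) * δ)
      ≤ (T : ℝ) ^ 2 * ∑ i ∈ s.filter (fun i : ℕ => ¬ |(i : ℝ) - μ| < T), q i := by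
        refine mul_le_mul_of_nonneg_left ?_ (sq_nonneg _)
        linarith
    _ = ∑ i ∈ s.filter (fun i : ℕ => ¬ |(i : ℝ) - μ| < T), (T : ℝ) ^ 2 * q i := Finset.mul_sum _ _ _
    _ ≤ ∑ i ∈ s.filter (fun i : ℕ => ¬ |(i : ℝ) - μ| < T), ((i : ℝ) - μ) ^ 2 * q i := by
        refine Finset.sum_le_sum fun i hi => mul_le_mul_of_nonneg_right ?_ (hq i)
        have := (Finset.mem_filter.1 hi).2
        rw [← sq_abs ((i : ℝ) - μ)]
        exact pow_le_pow_left₀ (Nat.cast_nonneg _) (not_lt.1 this) 2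
    _ ≤ _ := Finset.sum_le_sum_of_subset_of_nonneg (Finset.filter_subset _ _) fun i _ _ =>
        mul_nonneg (sq_nonneg _) (hq i)

open Polynomial Filter in
theorem tendsto_variance_of_coeff_le (R : ℕ → Multiset ℝ) (hR : ∀ n, ∀ r ∈ R n, 0 ≤ r)
    (hmax : ∀ δ > 0, ∀ᶠ n in atTop, ∀ i, ((R n).map fun r => X + C r).prod.coeff i ≤
      δ * ((R n).map fun r => X + C r).prod.eval 1) :
    Tendsto (fun n => ((R n).map fun r => 1 / (1 + r) * (1 - 1 / (1 + r))).sum) atTop atTop := by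
  rw [tendsto_atTop]
  intro b
  obtain ⟨T, hT⟩ := exists_nat_ge (max 1 (2 * b))
  have hT1 : (1 : ℝ) ≤ T := (le_max_left _ _).trans hT
  have hT2 : 2 * b ≤ T := (le_max_right _ _).trans hT
  filter_upwards [hmax (1 / (2 * (2 * T + 1))) (by positivity)] with n hn
  have h0 := eval_one_prod_X_add_C_pos (R n) (hR n)
  have hc := coeff_prod_X_add_C_nonneg (R n) (hR n)
  rw [← variance_coeffSeq_prod (R n) (hR n)]
  generalize ((R n).map fun r => X + C r).prod = F at *
  have h := mul_one_sub_le_sum_sq_sub_mul (Finset.range (F.natDegree + 1))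
    (fun i => F.coeff i / F.eval 1) (1 / (2 * (2 * T + 1))) (seqMean (coeffSeq F))
    (fun i => div_nonneg (hc i) h0.le) (fun i => (div_le_iff₀ h0).2 (hn i))
    (by
      rw [← Finset.sum_div, div_eq_one_iff_eq h0.ne', eval_eq_sum_range]
      simp) T
  rw [Finset.sum_div]
  have e : (T : ℝ) ^ 2 * (1 - (2 * T + 1) * (1 / (2 * (2 * T + 1)))) = T ^ 2 / 2 := by
    have : (2 * (T : ℝ) + 1) ≠ 0 := by positivity
    field_simp
    ring
  rw [e] at h
  calc b ≤ T ^ 2 / 2 := by nlinarith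
    _ ≤ _ := h
    _ = _ := Finset.sum_congr rfl fun i _ => by ring

/-- The weights `∏ (j + b) / j!`. -/
noncomputable def dobinskiWeight (B : Multiset ℝ) (j : ℕ) : ℝ :=
  (B.map fun b => (j : ℝ) + b).prod / (j.factorial : ℝ)

/-- The ratio of consecutive weights `∏ (j + b) / j!`. -/
noncomputable def dobinskiRatio (B : Multiset ℝ) (j : ℕ) : ℝ :=
  (B.map fun b => 1 + 1 / ((j : ℝ) + b)).prod / ((j : ℝ) + 1)

theorem Multiset.prod_map_pos_of_forall {α : Type*} (s : Multiset α) (f : α → ℝ)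
    (h : ∀ x ∈ s, 0 < f x) : 0 < (s.map f).prod := by
  induction s using Multiset.induction_on with
  | empty => simp
  | cons a s ih =>
    rw [map_cons, prod_cons]
    exact mul_pos (h a (mem_cons_self _ _)) (ih fun x hx => h x (mem_cons_of_mem hx))

theorem Multiset.prod_map_le_prod_map_of_nonneg {α : Type*} (s : Multiset α) (f g : α → ℝ)
    (h0 : ∀ x ∈ s, 0 < f x) (h : ∀ x ∈ s, f x ≤ g x) : (s.map f).prod ≤ (s.map g).prod := by
  induction s using Multiset.induction_on with
  | empty => simp
  | cons a s ih =>
    rw [map_cons, prod_cons, map_cons, prod_cons]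
    have ha := h0 a (mem_cons_self _ _)
    have hg := h a (mem_cons_self _ _)
    exact mul_le_mul hg
      (ih (fun x hx => h0 x (mem_cons_of_mem hx)) fun x hx => h x (mem_cons_of_mem hx))
      (prod_map_pos_of_forall _ _ fun x hx => h0 x (mem_cons_of_mem hx)).le (ha.le.trans hg)

theorem Multiset.one_add_sum_map_le_prod_map_one_add {α : Type*} (s : Multiset α) (f : α → ℝ)
    (h0 : ∀ x ∈ s, 0 ≤ f x) : 1 + (s.map f).sum ≤ (s.map fun x => 1 + f x).prod := by
  induction s using Multiset.induction_on with
  | empty => simp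
  | cons a s ih =>
    rw [map_cons, sum_cons, map_cons, prod_cons]
    have ha := h0 a (mem_cons_self _ _)
    have ih := ih fun x hx => h0 x (mem_cons_of_mem hx)
    have hs : 0 ≤ (s.map f).sum := by
      refine sum_nonneg fun y hy => ?_
      obtain ⟨x, hx, rfl⟩ := mem_map.1 hy
      exact h0 x (mem_cons_of_mem hx)
    nlinarith

section

variable {B : Multiset ℝ}

theorem dobinskiWeight_pos (hB : ∀ b ∈ B, 1 ≤ b) (j : ℕ) : 0 < dobinskiWeight B j := by
  refine div_pos (Multiset.prod_map_pos_of_forall _ _ fun b hb => ?_) (by positivity)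
  have := hB b hb
  positivity

theorem dobinskiRatio_pos (hB : ∀ b ∈ B, 1 ≤ b) (j : ℕ) : 0 < dobinskiRatio B j := by
  refine div_pos (Multiset.prod_map_pos_of_forall _ _ fun b hb => ?_) (by positivity)
  have := hB b hb
  positivity

theorem dobinskiWeight_succ (hB : ∀ b ∈ B, 1 ≤ b) (j : ℕ) :
    dobinskiWeight B (j + 1) = dobinskiWeight B j * dobinskiRatio B j := by
  rw [dobinskiWeight, dobinskiWeight, dobinskiRatio, div_mul_div_comm, ← Multiset.prod_map_mul,
    Nat.factorial_succ]
  congr 1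
  · refine congrArg _ (Multiset.map_congr rfl fun b hb => ?_)
    have := hB b hb
    have : (j : ℝ) + b ≠ 0 := by positivity
    field_simp
    push_cast
    ring
  · push_cast
    ring

theorem dobinskiRatio_antitone (hB : ∀ b ∈ B, 1 ≤ b) : Antitone (dobinskiRatio B) := by
  intro i j hij
  have hij' : (i : ℝ) ≤ j := by exact_mod_cast hij
  have hpos : ∀ k : ℕ, ∀ b ∈ B, 0 < 1 + 1 / ((k : ℝ) + b) := fun k b hb => by
    have := hB b hb
    positivity
  refine div_le_div₀ (Multiset.prod_map_pos_of_forall _ _ (hpos i)).le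
    (Multiset.prod_map_le_prod_map_of_nonneg _ _ _ (hpos j) fun b hb => ?_) (by positivity)
    (by linarith)
  have := hB b hb
  have : 1 / ((j : ℝ) + b) ≤ 1 / ((i : ℝ) + b) :=
    one_div_le_one_div_of_le (by positivity) (by linarith)
  linarith

theorem exists_dobinskiRatio_le_one (hB : ∀ b ∈ B, 1 ≤ b) : ∃ j, dobinskiRatio B j ≤ 1 := by
  refine ⟨max B.card 3, ?_⟩
  set j := max B.card 3 with hj
  have hj1 : (B.card : ℝ) ≤ j := by exact_mod_cast le_max_left _ _
  have hj2 : (3 : ℝ) ≤ j := by exact_mod_cast le_max_right _ _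
  have h1 : (B.map fun b => 1 + 1 / ((j : ℝ) + b)).prod ≤
      (B.map fun _ => Real.exp (1 / ((j : ℝ) + 1))).prod := by
    refine Multiset.prod_map_le_prod_map_of_nonneg _ _ _ (fun b hb => ?_) fun b hb => ?_
    · have := hB b hb
      positivity
    · have := hB b hb
      have h2 : 1 / ((j : ℝ) + b) ≤ 1 / ((j : ℝ) + 1) :=
        one_div_le_one_div_of_le (by positivity) (by linarith)
      have h3 := Real.add_one_le_exp (1 / ((j : ℝ) + 1))
      linarith
  rw [Multiset.map_const', Multiset.prod_replicate, ← Real.exp_nat_mul] at h1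
  rw [dobinskiRatio, div_le_one (by positivity)]
  have h2 : (B.card : ℝ) * (1 / ((j : ℝ) + 1)) ≤ 1 := by
    rw [mul_one_div, div_le_one (by positivity)]
    linarith
  have h3 := Real.exp_le_exp.2 h2
  have h4 := Real.exp_one_lt_d9
  linarith

theorem card_le_mul_of_dobinskiRatio_le_one (hB : ∀ b ∈ B, 1 ≤ b) {D : ℝ} (hD : ∀ b ∈ B, b ≤ D)
    (hD0 : 1 ≤ D) {j : ℕ} (hj : dobinskiRatio B j ≤ 1) : (B.card : ℝ) ≤ j * (j + D) := by
  rw [dobinskiRatio, div_le_one (by positivity)] at hj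
  have h1 := Multiset.one_add_sum_map_le_prod_map_one_add B (fun b => 1 / ((j : ℝ) + b))
    fun b hb => by
      have := hB b hb
      positivity
  have h2 : (B.map fun _ => 1 / ((j : ℝ) + D)).sum ≤ (B.map fun b => 1 / ((j : ℝ) + b)).sum := by
    refine Multiset.sum_map_le_sum_map _ _ fun b hb => ?_
    have := hB b hb
    exact one_div_le_one_div_of_le (by positivity) (by linarith [hD b hb])
  rw [Multiset.map_const', Multiset.sum_replicate, nsmul_eq_mul, mul_one_div] at h2
  have h3 : (B.card : ℝ) / (j + D) ≤ j := by linarith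
  rwa [div_le_iff₀ (by positivity)] at h3

theorem dobinskiRatio_le_of_dobinskiRatio_add_le_one (hB : ∀ b ∈ B, 1 ≤ b) {y L : ℕ} (hy : 1 ≤ y)
    (hyL : dobinskiRatio B (y + L) ≤ 1) :
    dobinskiRatio B y ≤ ((y : ℝ) + L + 1) ^ (1 + (L : ℝ) / y) / (y + 1) := by
  have hy' : (1 : ℝ) ≤ y := by exact_mod_cast hy
  rw [dobinskiRatio, div_le_one (by positivity)] at hyL
  push_cast at hyL
  refine div_le_div_of_nonneg_right ?_ (by positivity)
  have hpos : ∀ b ∈ B, 0 < 1 + 1 / ((y : ℝ) + L + b) := fun b hb => by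
    have := hB b hb
    positivity
  calc (B.map fun b => 1 + 1 / ((y : ℝ) + b)).prod
      ≤ (B.map fun b => (1 + 1 / ((y : ℝ) + L + b)) ^ (1 + (L : ℝ) / y)).prod := by
        refine Multiset.prod_map_le_prod_map_of_nonneg _ _ _ (fun b hb => ?_) fun b hb => ?_
        · have := hB b hb
          positivity
        have hb1 := hB b hb
        set x : ℝ := y + L + b with hx
        have hx0 : 0 < x := by positivity
        have hlog : 1 / (x + 1) ≤ Real.log (1 + 1 / x) := by
          have h := Real.one_sub_inv_le_log_of_pos (hpos b hb)
          refine le_trans (le_of_eq ?_) h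
          field_simp
          ring
        have h1 : 1 + 1 / ((y : ℝ) + b) =
            (1 + 1 / x) * (1 + (L : ℝ) / ((y + b) * (x + 1))) := by
          rw [hx]
          have : (y : ℝ) + b ≠ 0 := by positivity
          have : (y : ℝ) + L + b ≠ 0 := by positivity
          have : (y : ℝ) + L + b + 1 ≠ 0 := by positivity
          field_simp
          ring
        have h2 : (L : ℝ) / ((y + b) * (x + 1)) ≤ Real.log (1 + 1 / x) * (L / y) := by
          calc (L : ℝ) / ((y + b) * (x + 1)) ≤ (L : ℝ) / (y * (x + 1)) := by gcongr; linarith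
            _ = 1 / (x + 1) * (L / y) := by field_simp
            _ ≤ _ := by gcongr
        rw [Real.rpow_add (hpos b hb), Real.rpow_one, h1]
        refine mul_le_mul_of_nonneg_left ?_ (hpos b hb).le
        rw [Real.rpow_def_of_pos (hpos b hb)]
        have := Real.add_one_le_exp (Real.log (1 + 1 / x) * (L / y))
        linarith
    _ = ((B.map fun b => 1 + 1 / ((y : ℝ) + L + b)).prod) ^ (1 + (L : ℝ) / y) :=
        Real.multiset_prod_map_rpow _ _ (fun b hb => (hpos b hb).le) _
    _ ≤ ((y : ℝ) + L + 1) ^ (1 + (L : ℝ) / y) := by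
        refine Real.rpow_le_rpow ?_ hyL (by positivity)
        exact (Multiset.prod_map_pos_of_forall _ _ hpos).le

theorem dobinskiWeight_add_le (hB : ∀ b ∈ B, 1 ≤ b) {y : ℕ} {ψ : ℝ} (hψ : dobinskiRatio B y ≤ ψ)
    {k : ℕ} (hk : y ≤ k) (i : ℕ) : dobinskiWeight B (k + i) ≤ ψ ^ i * dobinskiWeight B k := by
  have hψ0 : 0 ≤ ψ := (dobinskiRatio_pos hB y).le.trans hψ
  induction i with
  | zero => simp
  | succ i ih =>
    rw [← add_assoc, dobinskiWeight_succ hB, pow_succ, mul_right_comm]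
    exact mul_le_mul ih ((dobinskiRatio_antitone hB (by omega)).trans hψ)
      (dobinskiRatio_pos hB _).le (mul_nonneg (pow_nonneg hψ0 _) (dobinskiWeight_pos hB _).le)

theorem dobinskiWeight_le_of_mode (hB : ∀ b ∈ B, 1 ≤ b) {m : ℕ} (hm : dobinskiRatio B m ≤ 1)
    (hm' : ∀ j < m, 1 ≤ dobinskiRatio B j) (j : ℕ) : dobinskiWeight B j ≤ dobinskiWeight B m := by
  rcases le_total m j with h | h
  · obtain ⟨i, rfl⟩ := Nat.exists_eq_add_of_le h
    simpa using dobinskiWeight_add_le hB hm le_rfl i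
  · induction h using Nat.decreasingInduction with
    | self => exact le_rfl
    | of_succ k hk ih =>
      refine le_trans ?_ ih
      rw [dobinskiWeight_succ hB]
      exact le_mul_of_one_le_right (dobinskiWeight_pos hB k).le (hm' k hk)

end

open Filter in
theorem tendsto_add_rpow_div_pow (L : ℕ) : Tendsto
    (fun y : ℕ => (((y : ℝ) + L + 1) ^ (1 + (L : ℝ) / y) / (y + 1)) ^ L) atTop (nhds 1) := by
  have hcast : Tendsto (fun y : ℕ => (y : ℝ)) atTop atTop := tendsto_natCast_atTop_atTop
  have h1 : Tendsto (fun y : ℕ => ((y : ℝ) + L + 1) / (y + 1)) atTop (nhds 1) := by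
    have h : Tendsto (fun y : ℕ => 1 + (L : ℝ) * ((y : ℝ) + 1)⁻¹) atTop (nhds (1 + L * 0)) :=
      ((tendsto_inv_atTop_zero.comp (tendsto_atTop_add_const_right _ 1 hcast)).const_mul
        (L : ℝ)).const_add 1
    rw [mul_zero, add_zero] at h
    refine h.congr fun y => ?_
    have : (y : ℝ) + 1 ≠ 0 := by positivity
    field_simp
    ring
  have h2 : Tendsto (fun y : ℕ => Real.log ((y : ℝ) + L + 1) * ((L : ℝ) / y)) atTop (nhds 0) := by
    have hx : Tendsto (fun y : ℕ => (y : ℝ) + L + 1) atTop atTop :=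
      tendsto_atTop_add_const_right _ 1 (tendsto_atTop_add_const_right _ _ hcast)
    have h := (Real.isLittleO_log_id_atTop.tendsto_div_nhds_zero).comp hx
    have h' : Tendsto (fun y : ℕ => (1 + ((L : ℝ) + 1) * (y : ℝ)⁻¹) * L) atTop
        (nhds ((1 + ((L : ℝ) + 1) * 0) * L)) :=
      (((tendsto_inv_atTop_zero.comp hcast).const_mul _).const_add 1).mul_const _
    have h3 := h.mul h'
    rw [zero_mul] at h3
    refine h3.congr' ?_
    filter_upwards [eventually_ge_atTop 1] with y hy
    have : (1 : ℝ) ≤ y := by exact_mod_cast hy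
    have : (y : ℝ) + L + 1 ≠ 0 := by positivity
    simp only [Function.comp, id]
    field_simp
    ring
  have h3 := (h1.mul ((Real.continuous_exp.tendsto _).comp h2)).pow L
  simp only [Real.exp_zero, mul_one, one_pow] at h3
  refine h3.congr fun y => ?_
  have : 0 < (y : ℝ) + L + 1 := by positivity
  rw [Real.rpow_add this, Real.rpow_one, Real.rpow_def_of_pos this]
  simp only [Function.comp]
  ring

theorem exists_dobinskiWeight_le_mul_sum {δ : ℝ} (hδ : 0 < δ) : ∃ K : ℝ, ∀ (B : Multiset ℝ) (D : ℝ),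
    1 ≤ D → (∀ b ∈ B, 1 ≤ b) → (∀ b ∈ B, b ≤ D) → K * D ≤ B.card →
      ∃ M, ∀ j, dobinskiWeight B j ≤ δ * ∑ i ∈ Finset.range M, dobinskiWeight B i := by
  obtain ⟨L, hL⟩ := exists_nat_ge (2 / δ)
  obtain ⟨y₀, hy₀⟩ := Filter.eventually_atTop.1
    ((tendsto_add_rpow_div_pow L).eventually (Iio_mem_nhds (by norm_num : (1 : ℝ) < 2)))
  set K : ℕ := y₀ + L + 1 with hK
  refine ⟨K * (K + 1), fun B D hD hB hBD hcard => ?_⟩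
  classical
  have hex := exists_dobinskiRatio_le_one hB
  set m := Nat.find hex with hm
  have hm1 : dobinskiRatio B m ≤ 1 := Nat.find_spec hex
  have hm2 : ∀ j < m, 1 ≤ dobinskiRatio B j := fun j hj => (not_le.1 (Nat.find_min hex hj)).le
  have hmK : K ≤ m := by
    by_contra h
    have h : (m : ℝ) + 1 ≤ K := by exact_mod_cast (not_le.1 h)
    have h1 := card_le_mul_of_dobinskiRatio_le_one hB hBD hD hm1
    have hm0 : (0 : ℝ) ≤ m := Nat.cast_nonneg _
    have h2 : (K : ℝ) * (K + 1) * D ≤ m * (m + D) := hcard.trans h1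
    have h3 : (m : ℝ) * (m + D) ≤ m * ((m + 1) * D) := by
      refine mul_le_mul_of_nonneg_left ?_ hm0
      nlinarith
    have h4 : (m : ℝ) * (m + 1) < K * (K + 1) := by nlinarith
    nlinarith
  obtain ⟨y, hy⟩ : ∃ y, m = y + L := ⟨m - L, by omega⟩
  have hyy : y₀ ≤ y := by omega
  have hy1 : 1 ≤ y := by omega
  set ψ : ℝ := ((y : ℝ) + L + 1) ^ (1 + (L : ℝ) / y) / (y + 1) with hψ
  have hψ1 : dobinskiRatio B y ≤ ψ :=
    dobinskiRatio_le_of_dobinskiRatio_add_le_one hB hy1 (by rw [← hy]; exact hm1)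
  have hψ2 : ψ ^ L < 2 := hy₀ y hyy
  have hψ3 : 1 ≤ ψ := by
    rw [hψ, one_le_div (by positivity)]
    calc (y : ℝ) + 1 ≤ (y : ℝ) + L + 1 := by linarith [(Nat.cast_nonneg L : (0 : ℝ) ≤ L)]
      _ = ((y : ℝ) + L + 1) ^ (1 : ℝ) := (Real.rpow_one _).symm
      _ ≤ _ := by
        refine Real.rpow_le_rpow_of_exponent_le ?_ ?_
        · have : (0 : ℝ) ≤ y + L := by positivity
          linarith
        · have : (0 : ℝ) ≤ (L : ℝ) / y := by positivity
          linarith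
  have hw : ∀ k ∈ Finset.range (L + 1), dobinskiWeight B m / 2 ≤ dobinskiWeight B (y + k) := by
    intro k hk
    have hk' : k ≤ L := Nat.lt_succ_iff.1 (Finset.mem_range.1 hk)
    have h := dobinskiWeight_add_le hB hψ1 (Nat.le_add_right y k) (L - k)
    rw [show y + k + (L - k) = m by omega] at h
    have h2 : ψ ^ (L - k) ≤ 2 := (pow_le_pow_right₀ hψ3 (Nat.sub_le _ _)).trans hψ2.le
    have h3 := mul_le_mul_of_nonneg_right h2 (dobinskiWeight_pos hB (y + k)).le
    linarith
  refine ⟨m + 1, fun j => (dobinskiWeight_le_of_mode hB hm1 hm2 j).trans ?_⟩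
  have hsum : ((L : ℝ) + 1) * (dobinskiWeight B m / 2) ≤
      ∑ i ∈ Finset.range (m + 1), dobinskiWeight B i := by
    rw [hy, add_assoc, Finset.sum_range_add, ← hy]
    have h := Finset.card_nsmul_le_sum _ _ _ hw
    rw [Finset.card_range, nsmul_eq_mul] at h
    push_cast at h
    have h0 : 0 ≤ ∑ i ∈ Finset.range y, dobinskiWeight B i :=
      Finset.sum_nonneg fun i _ => (dobinskiWeight_pos hB i).le
    linarith
  have hpos := dobinskiWeight_pos hB m
  rw [div_le_iff₀ hδ] at hL
  have h5 := mul_le_mul_of_nonneg_left hsum hδ.le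
  nlinarith

open Polynomial in
/-- The linear functional sending `X ^ k` to the falling factorial `q (q - 1) ⋯ (q - k + 1)`. -/
noncomputable def fallingEval (q : ℕ) : ℝ[X] →ₗ[ℝ] ℝ :=
  Polynomial.lsum fun k => (q.descFactorial k : ℝ) • LinearMap.id

open Polynomial in
/-- The effect on Stirling polynomials of adding a factor to the chromatic polynomial. -/
noncomputable def stirlingStep (b : ℝ) (g : ℝ[X]) : ℝ[X] :=
  (X + C b) * g + X * derivative g

open Polynomial in
/-- The Stirling polynomial obtained by successive steps with parameters in the list. -/
noncomputable def stirlingPoly (l : List ℝ) : ℝ[X] := l.foldr stirlingStep 1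

open Polynomial in
theorem fallingEval_monomial (q k : ℕ) (c : ℝ) :
    fallingEval q (monomial k c) = c * q.descFactorial k := by
  simp [fallingEval, lsum_apply, mul_comm]

open Polynomial in
theorem fallingEval_X_pow (q k : ℕ) : fallingEval q (X ^ k) = q.descFactorial k := by
  rw [X_pow_eq_monomial, fallingEval_monomial, one_mul]

open Polynomial in
theorem fallingEval_eq_sum_range (q : ℕ) (F : ℝ[X]) :
    fallingEval q F = ∑ k ∈ Finset.range (q + 1), F.coeff k * q.descFactorial k := by
  induction F using Polynomial.induction_on' with
  | add p r hp hr => simp [hp, hr, add_mul, Finset.sum_add_distrib]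
  | monomial n a =>
    rw [fallingEval_monomial]
    simp only [coeff_monomial, ite_mul, zero_mul, Finset.sum_ite_eq]
    split_ifs with h
    · rfl
    · rw [Nat.descFactorial_of_lt (by simpa using h)]
      simp

theorem Nat.cast_descFactorial_succ_real (q k : ℕ) :
    ((q.descFactorial (k + 1) : ℕ) : ℝ) = ((q : ℝ) - k) * q.descFactorial k := by
  rw [Nat.descFactorial_succ]
  rcases le_or_gt k q with h | h
  · push_cast [h]; ring
  · rw [Nat.descFactorial_of_lt h]; simp

open Polynomial in
theorem fallingEval_X_sub_C_mul_add (q : ℕ) (a : ℝ) (F : ℝ[X]) :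
    fallingEval q ((X - C a) * F + X * derivative F) = (q - a) * fallingEval q F := by
  induction F using Polynomial.induction_on' with
  | add p r hp hr =>
    have h : (X - C a) * (p + r) + X * derivative (p + r) =
        ((X - C a) * p + X * derivative p) + ((X - C a) * r + X * derivative r) := by
      rw [derivative_add]
      ring
    rw [h, map_add, hp, hr, map_add]
    ring
  | monomial n c =>
    have h : (X - C a) * monomial n c + X * derivative (monomial n c) =
        monomial (n + 1) c + monomial n ((n - a) * c) := by
      rw [sub_mul, X_mul_monomial, C_mul_monomial, derivative_monomial, X_mul_monomial]
      cases n with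
      | zero =>
        simp [sub_eq_add_neg]
      | succ n =>
        rw [Nat.add_sub_cancel, sub_add, ← map_sub, sub_eq_add_neg, ← map_neg]
        congr 2
        ring
    rw [h, map_add, fallingEval_monomial, fallingEval_monomial, fallingEval_monomial,
      Nat.cast_descFactorial_succ_real]
    ring

open Polynomial in
theorem fallingEval_X_pow_mul_stirlingPoly (q D : ℕ) (l : List ℝ) :
    fallingEval q (X ^ D * stirlingPoly l) =
      (l.map fun b => (q : ℝ) - D + b).prod * q.descFactorial D := by
  induction l with
  | nil => simp [stirlingPoly, fallingEval_X_pow]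
  | cons b l ih =>
    have h : X ^ D * stirlingPoly (b :: l) = (X - C ((D : ℝ) - b)) * (X ^ D * stirlingPoly l) +
        X * derivative (X ^ D * stirlingPoly l) := by
      change X ^ D * stirlingStep b (stirlingPoly l) = _
      rw [stirlingStep, derivative_mul, derivative_X_pow, C_sub, C_eq_natCast]
      cases D with
      | zero => simp
      | succ D => rw [Nat.add_sub_cancel, pow_succ]; ring
    rw [h, fallingEval_X_sub_C_mul_add, ih, List.map_cons, List.prod_cons]
    ring

open Polynomial in
theorem exists_prod_X_add_C_eq_stirlingStep (R : Multiset ℝ) (hR : ∀ r ∈ R, 0 ≤ r) {b : ℝ}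
    (hb : 0 < b) : ∃ R' : Multiset ℝ, (∀ r ∈ R', 0 ≤ r) ∧ Multiset.card R' = Multiset.card R + 1 ∧
      stirlingStep b (R.map fun r => X + C r).prod = (R'.map fun r => X + C r).prod := by
  set g : ℝ[X] := (R.map fun r => X + C r).prod with hg
  have hgm : g.Monic := monic_multiset_prod_of_monic _ _ fun r _ => monic_X_add_C r
  have hgs : (g.map (algebraMap ℝ ℂ)).Splits := IsAlgClosed.splits _
  have hgroots : ∀ z : ℂ, (g.map (algebraMap ℝ ℂ)).eval z = 0 → z.im = 0 := by
    intro z hz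
    rw [hg, Polynomial.map_multiset_prod, Multiset.map_map, eval_multiset_prod, Multiset.map_map,
      Multiset.prod_eq_zero_iff] at hz
    obtain ⟨r, -, hr⟩ := Multiset.mem_map.1 hz
    have := congrArg Complex.im hr
    simpa using this
  have hdeg : (X * derivative g).degree < ((X + C b) * g).degree := by
    rw [degree_mul, degree_mul, degree_X, degree_X_add_C]
    exact WithBot.add_lt_add_left (by simp) (degree_derivative_lt hgm.ne_zero)
  have hm : (stirlingStep b g).Monic := ((monic_X_add_C b).mul hgm).add_of_left hdeg
  have hnat : (stirlingStep b g).natDegree = Multiset.card R + 1 := by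
    rw [stirlingStep, natDegree_add_eq_left_of_degree_lt hdeg, (monic_X_add_C b).natDegree_mul hgm,
      natDegree_X_add_C, hg, natDegree_multiset_prod_of_monic _ fun p hp => by
        obtain ⟨r, -, rfl⟩ := Multiset.mem_map.1 hp
        exact monic_X_add_C r]
    simp [Multiset.map_map, add_comm]
  have hs : (stirlingStep b g).Splits := by
    refine Splits.of_splits_map (algebraMap ℝ ℂ) (IsAlgClosed.splits _) fun z hz => ?_
    have hz0 : ((stirlingStep b g).map (algebraMap ℝ ℂ)).eval z = 0 := (mem_roots'.1 hz).2
    suffices h : z.im = 0 from ⟨z.re, by apply Complex.ext <;> simp [h]⟩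
    by_contra him
    have hgz : (g.map (algebraMap ℝ ℂ)).eval z ≠ 0 := fun h => him (hgroots z h)
    have hzne : z ≠ 0 := fun h => him (by rw [h]; rfl)
    have hlog := hgs.eval_derivative_div_eval_of_ne_zero hgz
    have h1 : (derivative (g.map (algebraMap ℝ ℂ))).eval z / (g.map (algebraMap ℝ ℂ)).eval z =
        -(1 + b * z⁻¹) := by
      rw [stirlingStep] at hz0
      simp only [Polynomial.map_add, Polynomial.map_mul, map_X, map_C, eval_add, eval_mul, eval_X,
        eval_C, Complex.coe_algebraMap] at hz0
      rw [div_eq_iff hgz, derivative_map]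
      apply mul_left_cancel₀ hzne
      field_simp
      linear_combination hz0
    rw [h1] at hlog
    have h2 := congrArg (fun w : ℂ => z.im * w.im) hlog
    have h3 : z.im * (-(1 + b * z⁻¹)).im = b * z.im ^ 2 / Complex.normSq z := by
      simp [Complex.inv_im]
      ring
    have h4 : 0 < b * z.im ^ 2 / Complex.normSq z := by
      have := Complex.normSq_pos.2 hzne
      positivity
    have h5 : ∀ S : Multiset ℂ, (∀ w ∈ S, w.im = 0) →
        z.im * ((S.map fun w => 1 / (z - w)).sum).im ≤ 0 := by
      intro S hS
      induction S using Multiset.induction_on with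
      | empty => simp
      | cons w S ih =>
        rw [Multiset.map_cons, Multiset.sum_cons, Complex.add_im, mul_add]
        refine add_nonpos ?_ (ih fun v hv => hS v (Multiset.mem_cons_of_mem hv))
        rw [one_div, Complex.inv_im, Complex.sub_im, hS w (Multiset.mem_cons_self _ _), sub_zero,
          mul_div_assoc']
        refine div_nonpos_of_nonpos_of_nonneg ?_ (Complex.normSq_nonneg _)
        nlinarith [sq_nonneg z.im]
    have h6 := h5 (g.map (algebraMap ℝ ℂ)).roots fun w hw => hgroots w (mem_roots'.1 hw).2
    simp only [h3] at h2
    linarith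
  have hpos : ∀ x : ℝ, 0 < x → 0 < (stirlingStep b g).eval x := by
    intro x hx
    have h1 : ∀ i, 0 ≤ (stirlingStep b g).coeff i := by
      intro i
      have hgc := coeff_prod_X_add_C_nonneg R hR
      rw [stirlingStep, add_mul, coeff_add, coeff_add, coeff_C_mul]
      have hbc := mul_nonneg hb.le (hgc i)
      cases i with
      | zero => simpa using hbc
      | succ i =>
        rw [coeff_X_mul, coeff_X_mul, coeff_derivative]
        have h1 := hgc i
        have h2 := hgc (i + 1)
        positivity
    rw [eval_eq_sum_range]
    refine Finset.sum_pos' (fun i _ => mul_nonneg (h1 i) (pow_nonneg hx.le _))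
      ⟨_, Finset.self_mem_range_succ _, ?_⟩
    rw [coeff_natDegree, hm.leadingCoeff, one_mul]
    positivity
  refine ⟨(stirlingStep b g).roots.map fun x => -x, fun r hr => ?_, ?_, ?_⟩
  · obtain ⟨x, hx, rfl⟩ := Multiset.mem_map.1 hr
    have hx0 : (stirlingStep b g).eval x = 0 := (mem_roots'.1 hx).2
    by_contra h
    have := hpos x (by linarith)
    linarith
  · rw [Multiset.card_map, ← hs.natDegree_eq_card_roots, hnat]
  · conv_lhs => rw [hs.eq_prod_roots_of_monic hm]
    rw [Multiset.map_map]
    simp [sub_eq_add_neg]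

open Polynomial in
theorem exists_prod_X_add_C_eq_stirlingPoly (l : List ℝ) (hl : ∀ b ∈ l, 0 < b) :
    ∃ R : Multiset ℝ, (∀ r ∈ R, 0 ≤ r) ∧ Multiset.card R = l.length ∧
      stirlingPoly l = (R.map fun r => X + C r).prod := by
  induction l with
  | nil => exact ⟨0, by simp, rfl, by simp [stirlingPoly]⟩
  | cons b l ih =>
    obtain ⟨R, hR, hc, h⟩ := ih fun c hc => hl c (List.mem_cons_of_mem _ hc)
    obtain ⟨R', hR', hc', h'⟩ := exists_prod_X_add_C_eq_stirlingStep R hR (hl b List.mem_cons_self)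
    refine ⟨R', hR', by rw [hc', hc, List.length_cons], ?_⟩
    rw [← h', ← h]
    rfl

open Polynomial in
/-- Dobiński-type formula. -/
theorem dobinskiWeight_eq_sum (l : List ℝ) (j : ℕ) : dobinskiWeight l j =
    ∑ i ∈ Finset.range (j + 1), (stirlingPoly l).coeff i / ((j - i).factorial : ℝ) := by
  have h := fallingEval_X_pow_mul_stirlingPoly j 0 l
  rw [pow_zero, one_mul, Nat.descFactorial_zero, Nat.cast_one, mul_one, Nat.cast_zero] at h
  simp only [sub_zero] at h
  rw [dobinskiWeight, Multiset.map_coe, Multiset.prod_coe, ← h, fallingEval_eq_sum_range,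
    Finset.sum_div]
  refine Finset.sum_congr rfl fun i hi => ?_
  have hij : i ≤ j := Nat.lt_succ_iff.1 (Finset.mem_range.1 hi)
  have := Nat.factorial_mul_descFactorial hij
  have h2 : ((j - i).factorial : ℝ) * j.descFactorial i = j.factorial := by exact_mod_cast this
  rw [← h2]
  have h3 : ((j - i).factorial : ℝ) ≠ 0 := by positivity
  have h4 : (j.descFactorial i : ℝ) ≠ 0 := by
    rw [Nat.cast_ne_zero]
    exact (Nat.descFactorial_pos.2 hij).ne'
  field_simp

open Polynomial in
theorem stirlingPoly_coeff_nonneg (l : List ℝ) (hl : ∀ b ∈ l, 0 < b) (i : ℕ) :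
    0 ≤ (stirlingPoly l).coeff i := by
  obtain ⟨R, hR, -, h⟩ := exists_prod_X_add_C_eq_stirlingPoly l hl
  rw [h]
  exact coeff_prod_X_add_C_nonneg R hR i

open Polynomial in
theorem sum_dobinskiWeight_le (l : List ℝ) (hl : ∀ b ∈ l, 0 < b) (M : ℕ) :
    ∑ j ∈ Finset.range M, dobinskiWeight l j ≤ Real.exp 1 * (stirlingPoly l).eval 1 := by
  have hc := stirlingPoly_coeff_nonneg l hl
  have h1 : ∑ i ∈ Finset.range M, (stirlingPoly l).coeff i ≤ (stirlingPoly l).eval 1 := by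
    rw [eval_eq_sum_range' (n := M + (stirlingPoly l).natDegree + 1) (by omega)]
    simp only [one_pow, mul_one]
    exact Finset.sum_le_sum_of_subset_of_nonneg (Finset.range_mono (by omega)) fun i _ _ => hc i
  simp only [dobinskiWeight_eq_sum]
  rw [Finset.sum_comm' (t' := Finset.range M) (s' := fun i => Finset.Ico i M)
    fun j i => by simp only [Finset.mem_range, Finset.mem_Ico]; omega]
  calc ∑ i ∈ Finset.range M, ∑ j ∈ Finset.Ico i M,
        (stirlingPoly l).coeff i / ((j - i).factorial : ℝ)
      ≤ ∑ i ∈ Finset.range M, Real.exp 1 * (stirlingPoly l).coeff i := by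
        refine Finset.sum_le_sum fun i _ => ?_
        rw [Finset.sum_Ico_eq_sum_range]
        have h := mul_le_mul_of_nonneg_right
          (Real.sum_le_exp_of_nonneg zero_le_one (M - i)) (hc i)
        refine le_trans (le_of_eq ?_) h
        rw [Finset.sum_mul]
        refine Finset.sum_congr rfl fun k _ => ?_
        rw [Nat.add_sub_cancel_left, one_pow]
        ring
    _ ≤ Real.exp 1 * (stirlingPoly l).eval 1 := by
        rw [← Finset.mul_sum]
        exact mul_le_mul_of_nonneg_left h1 (Real.exp_pos 1).le

open Polynomial in
theorem stirlingPoly_coeff_le_dobinskiWeight (l : List ℝ) (hl : ∀ b ∈ l, 0 < b) (j : ℕ) :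
    (stirlingPoly l).coeff j ≤ dobinskiWeight l j := by
  rw [dobinskiWeight_eq_sum, Finset.sum_range_succ]
  simp only [Nat.sub_self, Nat.factorial_zero, Nat.cast_one, div_one, le_add_iff_nonneg_left]
  exact Finset.sum_nonneg fun i _ => div_nonneg (stirlingPoly_coeff_nonneg l hl i) (by positivity)

theorem addDom_adj_some_some {V : Type} (G : SimpleGraph V) (u v : V) :
    (addDom G).Adj (some u) (some v) ↔ G.Adj u v := by
  simp only [addDom, SimpleGraph.fromRel_adj, Option.some.injEq, reduceCtorEq, or_false, ne_eq]
  constructor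
  · rintro ⟨-, ⟨a, b, rfl, rfl, h⟩ | ⟨a, b, rfl, rfl, h⟩⟩
    exacts [h, h.symm]
  · exact fun h => ⟨h.ne, Or.inl ⟨u, v, rfl, rfl, h⟩⟩

theorem addDom_adj_none_some {V : Type} (G : SimpleGraph V) (v : V) :
    (addDom G).Adj none (some v) := by
  simp [addDom, SimpleGraph.fromRel_adj]

theorem disjUnion_adj_inl_inl {V W : Type} (G : SimpleGraph V) (H : SimpleGraph W) (u v : V) :
    (disjUnion G H).Adj (Sum.inl u) (Sum.inl v) ↔ G.Adj u v := by
  simp only [disjUnion, SimpleGraph.fromRel_adj, Sum.inl.injEq, reduceCtorEq, ne_eq]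
  constructor
  · rintro ⟨-, (⟨a, b, rfl, rfl, h⟩ | ⟨a, b, h, -⟩) | (⟨a, b, rfl, rfl, h⟩ | ⟨a, b, h, -⟩)⟩
    exacts [h, h.elim, h.symm, h.elim]
  · exact fun h => ⟨h.ne, Or.inl (Or.inl ⟨u, v, rfl, rfl, h⟩)⟩

theorem disjUnion_adj_inr_inr {V W : Type} (G : SimpleGraph V) (H : SimpleGraph W) (u v : W) :
    (disjUnion G H).Adj (Sum.inr u) (Sum.inr v) ↔ H.Adj u v := by
  simp only [disjUnion, SimpleGraph.fromRel_adj, Sum.inr.injEq, reduceCtorEq, ne_eq]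
  constructor
  · rintro ⟨-, (⟨a, b, h, -⟩ | ⟨a, b, rfl, rfl, h⟩) | (⟨a, b, h, -⟩ | ⟨a, b, rfl, rfl, h⟩)⟩
    exacts [h.elim, h, h.elim, h.symm]
  · exact fun h => ⟨h.ne, Or.inl (Or.inr ⟨u, v, rfl, rfl, h⟩)⟩

theorem not_disjUnion_adj_inl_inr {V W : Type} (G : SimpleGraph V) (H : SimpleGraph W) (u : V)
    (v : W) : ¬ (disjUnion G H).Adj (Sum.inl u) (Sum.inr v) := by
  simp [disjUnion, SimpleGraph.fromRel_adj]

theorem colorCount_addDom_zero {V : Type} (G : SimpleGraph V) : colorCount (addDom G) 0 = 0 := by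
  have : IsEmpty {c : Option V → Fin 0 // ∀ u v, (addDom G).Adj u v → c u ≠ c v} :=
    ⟨fun c => (c.1 none).elim0⟩
  exact Nat.card_of_isEmpty

theorem colorCount_addDom_succ {V : Type} (G : SimpleGraph V) (q : ℕ) :
    colorCount (addDom G) (q + 1) = (q + 1) * colorCount G q := by
  let F : Fin (q + 1) × {c : V → Fin q // ∀ u v : V, G.Adj u v → c u ≠ c v} →
      {c : Option V → Fin (q + 1) // ∀ u v, (addDom G).Adj u v → c u ≠ c v} :=
    fun x => ⟨fun o => o.elim x.1 fun v => x.1.succAbove (x.2.1 v), fun u v h => by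
      rcases u with _ | u <;> rcases v with _ | v
      · exact absurd h (SimpleGraph.irrefl _)
      · exact (Fin.succAbove_ne _ _).symm
      · exact Fin.succAbove_ne _ _
      · exact fun e => x.2.2 u v ((addDom_adj_some_some G u v).1 h)
          (Fin.succAbove_right_injective e)⟩
  have hF : Function.Bijective F := by
    constructor
    · rintro ⟨x, c, hc⟩ ⟨y, d, hd⟩ h
      have h' := congrArg Subtype.val h
      obtain rfl : x = y := congrFun h' none
      have : c = d := funext fun v => Fin.succAbove_right_injective (congrFun h' (some v))
      subst this
      rfl
    · rintro ⟨c, hc⟩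
      have h : ∀ v, ∃ y, (c none).succAbove y = c (some v) := fun v =>
        Fin.exists_succAbove_eq (hc _ _ (addDom_adj_none_some G v)).symm
      choose d hd using h
      refine ⟨(c none, ⟨d, fun u v huv e => ?_⟩), ?_⟩
      · exact hc _ _ ((addDom_adj_some_some G u v).2 huv) (by rw [← hd, ← hd, e])
      · refine Subtype.ext (funext fun o => ?_)
        rcases o with _ | v
        · rfl
        · exact hd v
  rw [colorCount, ← Nat.card_congr (Equiv.ofBijective F hF), Nat.card_prod, Nat.card_fin]
  rfl

theorem colorCount_disjUnion {V W : Type} (G : SimpleGraph V) (H : SimpleGraph W) (q : ℕ) :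
    colorCount (disjUnion G H) q = colorCount G q * colorCount H q := by
  rw [colorCount, colorCount, colorCount, ← Nat.card_prod]
  refine Nat.card_congr
    { toFun := fun c => (⟨fun v => c.1 (Sum.inl v), fun u v h =>
          c.2 _ _ ((disjUnion_adj_inl_inl G H u v).2 h)⟩,
        ⟨fun v => c.1 (Sum.inr v), fun u v h => c.2 _ _ ((disjUnion_adj_inr_inr G H u v).2 h)⟩)
      invFun := fun x => ⟨Sum.elim x.1.1 x.2.1, fun u v h => by
        rcases u with u | u <;> rcases v with v | v
        · exact x.1.2 u v ((disjUnion_adj_inl_inl G H u v).1 h)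
        · exact absurd h (not_disjUnion_adj_inl_inr G H u v)
        · exact absurd h.symm (not_disjUnion_adj_inl_inr G H v u)
        · exact x.2.2 u v ((disjUnion_adj_inr_inr G H u v).1 h)⟩
      left_inv := fun c => Subtype.ext (funext fun u => by rcases u with u | u <;> rfl)
      right_inv := fun x => rfl }

theorem colorCount_congr {V W : Type} {G : SimpleGraph V} {H : SimpleGraph W} (e : G ≃g H) (q : ℕ) :
    colorCount G q = colorCount H q := by
  refine Nat.card_congr ((e.toEquiv.arrowCongr (Equiv.refl (Fin q))).subtypeEquiv fun c => ?_)
  constructor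
  · intro h u v huv
    exact h _ _ ((SimpleGraph.Iso.map_adj_iff e.symm).2 huv)
  · intro h u v huv
    have h' := h _ _ ((SimpleGraph.Iso.map_adj_iff e).2 huv)
    change c (e.symm (e u)) ≠ c (e.symm (e v)) at h'
    rwa [e.symm_apply_apply, e.symm_apply_apply] at h'

theorem IsQuasiThreshold.exists_colorCount_eq {V : Type} {G : SimpleGraph V}
    (h : IsQuasiThreshold G) : ∃ s : Multiset ℕ, 0 ∈ s ∧ (∀ a ∈ s, ∀ b < a, b ∈ s) ∧
      ∀ q, colorCount G q = (s.map fun a => q - a).prod := by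
  induction h with
  | single =>
    refine ⟨{0}, by simp, by simp, fun q => ?_⟩
    have : ∀ c : PUnit.{1} → Fin q, ∀ u v, (⊥ : SimpleGraph PUnit).Adj u v → c u ≠ c v :=
      fun c u v h => h.elim
    rw [colorCount, Nat.card_congr (Equiv.subtypeUnivEquiv this)]
    simp
  | @addDominating V G _ ih =>
    obtain ⟨s, -, hs, hq⟩ := ih
    refine ⟨0 ::ₘ s.map (· + 1), by simp, ?_, fun q => ?_⟩
    · intro a ha b hb
      rcases Multiset.mem_cons.1 ha with rfl | ha
      · omega
      · obtain ⟨c, hc, rfl⟩ := Multiset.mem_map.1 ha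
        rcases b with _ | b
        · simp
        · exact Multiset.mem_cons_of_mem
            (Multiset.mem_map_of_mem _ (hs c hc b (by omega)))
    · cases q with
      | zero => simp [colorCount_addDom_zero]
      | succ q =>
        rw [colorCount_addDom_succ, hq, Multiset.map_cons, Multiset.prod_cons, Multiset.map_map]
        simp
  | @union V W G H _ _ ih₁ ih₂ =>
    obtain ⟨s, hs0, hs, hq⟩ := ih₁
    obtain ⟨t, -, ht, hq'⟩ := ih₂
    refine ⟨s + t, Multiset.mem_add.2 (Or.inl hs0), fun a ha b hb => ?_, fun q => ?_⟩
    · rcases Multiset.mem_add.1 ha with ha | ha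
      · exact Multiset.mem_add.2 (Or.inl (hs a ha b hb))
      · exact Multiset.mem_add.2 (Or.inr (ht a ha b hb))
    · rw [colorCount_disjUnion, hq, hq', Multiset.map_add, Multiset.prod_add]
  | iso _ e ih =>
    obtain ⟨s, hs0, hs, hq⟩ := ih
    exact ⟨s, hs0, hs, fun q => by rw [← colorCount_congr e, hq]⟩

open Polynomial in
theorem IsQuasiThreshold.exists_colorCount_eq_fallingEval {V : Type} {G : SimpleGraph V}
    (h : IsQuasiThreshold G) : ∃ (D : ℕ) (l : List ℝ), 1 ≤ D ∧ (∀ b ∈ l, 1 ≤ b) ∧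
      (∀ b ∈ l, b ≤ D) ∧ ∀ q, (colorCount G q : ℝ) = fallingEval q (X ^ D * stirlingPoly l) := by
  obtain ⟨s, hs0, hs, hq⟩ := h.exists_colorCount_eq
  obtain ⟨m, hm, hmax⟩ := s.toFinset.exists_max_image id ⟨0, by simpa using hs0⟩
  simp only [Multiset.mem_toFinset, id_eq] at hm hmax
  have hr : Multiset.range (m + 1) ≤ s := by
    rw [Multiset.le_iff_subset (Multiset.nodup_range _)]
    intro a ha
    rcases (Nat.lt_succ_iff.1 (Multiset.mem_range.1 ha)).lt_or_eq with h | rfl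
    exacts [hs m hm a h, hm]
  obtain ⟨t, rfl⟩ := Multiset.le_iff_exists_add.1 hr
  have ht : ∀ a ∈ t, (a : ℝ) + 1 ≤ (m + 1 : ℕ) := fun a ha => by
    exact_mod_cast Nat.succ_le_succ (hmax a (Multiset.mem_add.2 (Or.inr ha)))
  refine ⟨m + 1, t.toList.map fun a : ℕ => ((m + 1 : ℕ) : ℝ) - (a : ℝ), by omega, ?_, ?_, fun q => ?_⟩
  · simp only [List.mem_map, Multiset.mem_toList]
    rintro b ⟨a, ha, rfl⟩
    linarith [ht a ha]
  · simp only [List.mem_map, Multiset.mem_toList]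
    rintro b ⟨a, ha, rfl⟩
    linarith [a.cast_nonneg (α := ℝ)]
  · have hd : q.descFactorial (m + 1) = ((Multiset.range (m + 1)).map fun a => q - a).prod := by
      rw [Nat.descFactorial_eq_prod_range]
      rfl
    rw [fallingEval_X_pow_mul_stirlingPoly, hq, Multiset.map_add, Multiset.prod_add, ← hd,
      Nat.cast_mul, mul_comm]
    rcases lt_or_ge q (m + 1) with hlt | hge
    · rw [Nat.descFactorial_of_lt hlt]
      simp
    · congr 1
      rw [← Multiset.coe_toList t, Multiset.map_coe, Multiset.prod_coe, Nat.cast_list_prod,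
        List.map_map, List.map_map, Multiset.coe_toList]
      refine congrArg List.prod (List.map_congr_left fun a ha => ?_)
      have ha' : a ≤ m := hmax a (Multiset.mem_add.2 (Or.inr (Multiset.mem_toList.1 ha)))
      simp only [Function.comp_apply]
      rw [Nat.cast_sub (by omega)]
      ring

/-- Partitions of the vertex set into non-empty independent sets. -/
def SimpleGraph.IsIndepPartition {V : Type*} (G : SimpleGraph V) (P : Finset (Finset V)) : Prop :=
  (∀ p ∈ P, p.Nonempty) ∧ (∀ v : V, ∃! p, p ∈ P ∧ v ∈ p) ∧
    ∀ p ∈ P, ∀ u ∈ p, ∀ v ∈ p, ¬ G.Adj u v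

open Classical in
theorem colorCount_eq_sum_isIndepPartition {V : Type*} [Fintype V] (G : SimpleGraph V) (q : ℕ) :
    colorCount G q = ∑ P : {P // G.IsIndepPartition P}, q.descFactorial P.1.card := by
  have huniq : ∀ P, G.IsIndepPartition P → ∀ v, ∃ p : P, v ∈ p.1 ∧ ∀ p' : P, v ∈ p'.1 → p' = p := by
    intro P hP v
    obtain ⟨p, ⟨hp, hv⟩, hu⟩ := hP.2.1 v
    exact ⟨⟨p, hp⟩, hv, fun p' hv' => Subtype.ext (hu p'.1 ⟨p'.2, hv'⟩)⟩
  choose cls hmem heq using huniq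
  let F : (Σ P : {P // G.IsIndepPartition P}, (P.1 ↪ Fin q)) →
      {c : V → Fin q // ∀ u v : V, G.Adj u v → c u ≠ c v} :=
    fun x => ⟨fun v => x.2 (cls x.1.1 x.1.2 v), fun u v huv e => by
      have h := x.2.injective e
      exact x.1.2.2.2 _ (cls x.1.1 x.1.2 u).2 u (hmem _ _ u) v (h ▸ hmem _ _ v) huv⟩
  have hfib : ∀ x p, p ∈ x.1.1 ↔
      p ∈ Finset.univ.image fun v => Finset.univ.filter fun u => (F x).1 u = (F x).1 v := by
    intro x p
    have hcls : ∀ v, (Finset.univ.filter fun u => (F x).1 u = (F x).1 v) =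
        (cls x.1.1 x.1.2 v).1 := by
      intro v
      ext u
      simp only [Finset.mem_filter, Finset.mem_univ, true_and]
      constructor
      · intro h
        rw [← x.2.injective h]
        exact hmem _ _ u
      · intro h
        exact congrArg x.2 (heq _ x.1.2 u _ h).symm
    simp only [Finset.mem_image, Finset.mem_univ, true_and, hcls]
    constructor
    · intro hp
      obtain ⟨v, hv⟩ := x.1.2.1 p hp
      exact ⟨v, congrArg Subtype.val (heq _ x.1.2 v ⟨p, hp⟩ hv).symm⟩
    · rintro ⟨v, rfl⟩
      exact (cls _ _ v).2
  have hF : Function.Bijective F := by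
    constructor
    · intro x y hxy
      have hP : x.1.1 = y.1.1 := by
        ext p
        rw [hfib, hfib, hxy]
      obtain ⟨⟨P, hP1⟩, e⟩ := x
      obtain ⟨⟨P', hP2⟩, e'⟩ := y
      obtain rfl : P = P' := hP
      have : e = e' := by
        ext p : 1
        obtain ⟨v, hv⟩ := hP1.1 p.1 p.2
        have h := congrFun (congrArg Subtype.val hxy) v
        rw [heq P hP1 v p hv]
        exact h
      rw [this]
    · rintro ⟨c, hc⟩
      let P : Finset (Finset V) := Finset.univ.image fun v => Finset.univ.filter fun u => c u = c v
      have hPc : ∀ p ∈ P, ∀ u ∈ p, ∀ v, v ∈ p ↔ c v = c u := by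
        intro p hp u hu v
        obtain ⟨w, -, rfl⟩ := Finset.mem_image.1 hp
        simp only [Finset.mem_filter, Finset.mem_univ, true_and] at hu ⊢
        rw [hu]
      have hP : G.IsIndepPartition P := by
        refine ⟨fun p hp => ?_, fun v => ?_, fun p hp u hu v hv huv => ?_⟩
        · obtain ⟨w, -, rfl⟩ := Finset.mem_image.1 hp
          exact ⟨w, by simp⟩
        · refine ⟨Finset.univ.filter fun u => c u = c v,
            ⟨Finset.mem_image_of_mem _ (Finset.mem_univ v), by simp⟩, ?_⟩
          rintro p ⟨hp, hv⟩
          ext u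
          rw [hPc p hp v hv u]
          simp
        · exact hc u v huv ((hPc p hp v hv u).1 hu)
      let e : P ↪ Fin q := ⟨fun p => c (hP.1 p.1 p.2).choose, fun p p' h => by
        have h1 := (hP.1 p.1 p.2).choose_spec
        have h2 := (hP.1 p'.1 p'.2).choose_spec
        ext u
        rw [hPc p.1 p.2 _ h1, hPc p'.1 p'.2 _ h2]
        exact Eq.congr_right h⟩
      refine ⟨⟨⟨P, hP⟩, e⟩, Subtype.ext (funext fun v => ?_)⟩
      have h := (hP.1 (cls P hP v).1 (cls P hP v).2).choose_spec
      exact ((hPc _ (cls P hP v).2 v (hmem P hP v) _).1 h)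
  rw [colorCount, ← Nat.card_congr (Equiv.ofBijective F hF), Nat.card_eq_fintype_card,
    Fintype.card_sigma]
  refine Finset.sum_congr rfl fun P _ => ?_
  rw [Fintype.card_embedding_eq, Fintype.card_fin, Fintype.card_coe]

theorem colorCount_eq_sum_graphStirling {V : Type*} [Fintype V] (G : SimpleGraph V) (q : ℕ) :
    colorCount G q = ∑ k ∈ Finset.range (q + 1), graphStirling G k * q.descFactorial k := by
  classical
  have h : ∀ k, graphStirling G k =
      ∑ P : {P // G.IsIndepPartition P}, if P.1.card = k then 1 else 0 := by
    intro k
    rw [Finset.sum_boole, Nat.cast_id, ← Fintype.card_subtype, ← Nat.card_eq_fintype_card]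
    exact Nat.card_congr ((Equiv.subtypeEquivRight fun P => and_comm).trans
      (Equiv.subtypeSubtypeEquivSubtypeInter _ _).symm)
  simp only [h, Finset.sum_mul]
  rw [colorCount_eq_sum_isIndepPartition, Finset.sum_comm]
  refine Finset.sum_congr rfl fun P _ => ?_
  simp only [ite_mul, one_mul, zero_mul, Finset.sum_ite_eq]
  split_ifs with hP
  · rfl
  · exact Nat.descFactorial_of_lt (by simpa using hP)

theorem graphStirling_card_ne_zero {V : Type*} [Fintype V] (G : SimpleGraph V) :
    graphStirling G (Fintype.card V) ≠ 0 := by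
  classical
  have : Nonempty {P : Finset (Finset V) // P.card = Fintype.card V ∧ (∀ p ∈ P, p.Nonempty) ∧
      (∀ v : V, ∃! p, p ∈ P ∧ v ∈ p) ∧ ∀ p ∈ P, ∀ u ∈ p, ∀ v ∈ p, ¬ G.Adj u v} := by
    refine ⟨Finset.univ.image singleton, ?_, ?_, fun v => ⟨{v}, by simp, ?_⟩, ?_⟩
    · rw [Finset.card_image_of_injective _ Finset.singleton_injective, Finset.card_univ]
    · simp
    · rintro p ⟨hp, hv⟩
      obtain ⟨w, -, rfl⟩ := Finset.mem_image.1 hp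
      rw [Finset.mem_singleton.1 hv]
    · simp
  exact Nat.card_pos.ne'

theorem eq_of_sum_mul_descFactorial_eq {a b : ℕ → ℝ}
    (h : ∀ q : ℕ, ∑ k ∈ Finset.range (q + 1), a k * q.descFactorial k =
      ∑ k ∈ Finset.range (q + 1), b k * q.descFactorial k) (k : ℕ) : a k = b k := by
  induction k using Nat.strong_induction_on with
  | _ k ih =>
    have hk := h k
    rw [Finset.sum_range_succ, Finset.sum_range_succ, Finset.sum_congr rfl fun i hi => by
      rw [ih i (Finset.mem_range.1 hi)], add_right_inj, Nat.descFactorial_self] at hk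
    exact mul_right_cancel₀ (Nat.cast_ne_zero.2 k.factorial_ne_zero) hk

theorem colorable_iff_colorCount_ne_zero {V : Type*} [Fintype V] (G : SimpleGraph V) (q : ℕ) :
    G.Colorable q ↔ colorCount G q ≠ 0 := by
  rw [colorCount, Nat.card_ne_zero]
  constructor
  · rintro ⟨c⟩
    exact ⟨⟨c, fun u v h => c.valid h⟩, inferInstance⟩
  · rintro ⟨⟨c⟩, -⟩
    exact ⟨SimpleGraph.Coloring.mk c.1 fun {u v} h => c.2 u v h⟩

open Polynomial in
theorem natDegree_prod_X_add_C (R : Multiset ℝ) :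
    (R.map fun r => X + C r).prod.natDegree = Multiset.card R := by
  rw [natDegree_multiset_prod_of_monic _ fun p hp => by
    obtain ⟨r, -, rfl⟩ := Multiset.mem_map.1 hp
    exact monic_X_add_C r]
  simp [Multiset.map_map]

open Polynomial in
theorem exists_graphStirling_eq_coeff {V W : Type} [Fintype V] {G : SimpleGraph V}
    {H : SimpleGraph W} (hH : IsQuasiThreshold H) (hGH : CoChromatic G H) :
    ∃ (D : ℕ) (l : List ℝ), 1 ≤ D ∧ (∀ b ∈ l, 1 ≤ b) ∧ (∀ b ∈ l, b ≤ D) ∧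
      G.chromaticNumber.toNat = D ∧ Fintype.card V ≤ D + l.length ∧
      ∀ k, (graphStirling G k : ℝ) = (X ^ D * stirlingPoly l).coeff k := by
  obtain ⟨D, l, hD, h1, h2, hq⟩ := hH.exists_colorCount_eq_fallingEval
  have hq' : ∀ q, (colorCount G q : ℝ) = fallingEval q (X ^ D * stirlingPoly l) := fun q => by
    rw [hGH q, hq]
  have hc : ∀ k, (graphStirling G k : ℝ) = (X ^ D * stirlingPoly l).coeff k :=
    eq_of_sum_mul_descFactorial_eq fun q => by
      rw [← fallingEval_eq_sum_range, ← hq', colorCount_eq_sum_graphStirling]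
      push_cast
      rfl
  refine ⟨D, l, hD, h1, h2, ?_, ?_, hc⟩
  · have hcol : G.Colorable D := by
      rw [colorable_iff_colorCount_ne_zero, ← Nat.cast_ne_zero (R := ℝ), hq',
        fallingEval_X_pow_mul_stirlingPoly, Nat.descFactorial_self]
      refine mul_ne_zero (List.prod_ne_zero fun h => ?_) (Nat.cast_ne_zero.2 D.factorial_ne_zero)
      obtain ⟨b, hb, h⟩ := List.mem_map.1 h
      linarith [h1 b hb]
    have hncol : ¬ G.Colorable (D - 1) := by
      rw [colorable_iff_colorCount_ne_zero, ← Nat.cast_ne_zero (R := ℝ), hq',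
        fallingEval_X_pow_mul_stirlingPoly, Nat.descFactorial_of_lt (by omega)]
      simp
    obtain ⟨d, rfl⟩ := Nat.exists_eq_add_of_le' hD
    rw [SimpleGraph.chromaticNumber_eq_iff_colorable_not_colorable.2 ⟨hcol, hncol⟩]
    rfl
  · obtain ⟨R, -, hR, h⟩ := exists_prod_X_add_C_eq_stirlingPoly l fun b hb =>
      zero_lt_one.trans_le (h1 b hb)
    have hne := graphStirling_card_ne_zero G
    rw [← Nat.cast_ne_zero (R := ℝ), hc] at hne
    refine (le_natDegree_of_ne_zero hne).trans (natDegree_mul_le.trans ?_)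
    rw [natDegree_X_pow, h, natDegree_prod_X_add_C, hR]

open Polynomial in
theorem exists_coeff_stirlingPoly_le_mul_eval_one {δ : ℝ} (hδ : 0 < δ) : ∃ K : ℝ, ∀ (l : List ℝ)
    (D : ℕ), 1 ≤ D → (∀ b ∈ l, 1 ≤ b) → (∀ b ∈ l, b ≤ D) → K * D ≤ l.length →
      ∀ i, (X ^ D * stirlingPoly l).coeff i ≤ δ * (X ^ D * stirlingPoly l).eval 1 := by
  obtain ⟨K, hK⟩ := exists_dobinskiWeight_le_mul_sum (div_pos hδ (Real.exp_pos 1))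
  refine ⟨K, fun l D hD h1 h2 hl i => ?_⟩
  have h0 : ∀ b ∈ l, 0 < b := fun b hb => zero_lt_one.trans_le (h1 b hb)
  obtain ⟨M, hM⟩ := hK l D (by exact_mod_cast hD) h1 h2 hl
  have hle : ∀ j, (stirlingPoly l).coeff j ≤ δ * (stirlingPoly l).eval 1 := fun j =>
    calc (stirlingPoly l).coeff j ≤ dobinskiWeight l j := stirlingPoly_coeff_le_dobinskiWeight l h0 j
      _ ≤ δ / Real.exp 1 * ∑ i ∈ Finset.range M, dobinskiWeight l i := hM j
      _ ≤ δ / Real.exp 1 * (Real.exp 1 * (stirlingPoly l).eval 1) :=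
          mul_le_mul_of_nonneg_left (sum_dobinskiWeight_le l h0 M) (by positivity)
      _ = δ * (stirlingPoly l).eval 1 := by field_simp
  rw [coeff_X_pow_mul', eval_mul, eval_pow, eval_X, one_pow, one_mul]
  split_ifs
  · exact hle _
  · exact (stirlingPoly_coeff_nonneg l h0 0).trans (hle 0)

/-- The main theorem: if each `G n` is quasi-threshold or co-chromatic with a quasi-threshold
graph, the number of vertices `f n` tends to infinity and `g n = χ(G n)/f n` tends to zero,
then the graph Stirling sequence of `G n` is asymptotically normal. -/
theorem quasiThreshold_graphStirling_asymptotically_normal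
    (V : ℕ → Type) [∀ n, Fintype (V n)] (G : ∀ n, SimpleGraph (V n))
    (hQT : ∀ n, IsQuasiThreshold (G n) ∨
      ∃ (W : Type) (_ : Fintype W) (H : SimpleGraph W),
        IsQuasiThreshold H ∧ CoChromatic (G n) H)
    (f : ℕ → ℕ) (hf : ∀ n, f n = Fintype.card (V n))
    (g : ℕ → ℝ) (hg : ∀ n, g n = ((G n).chromaticNumber.toNat : ℝ) / (f n : ℝ))
    (hftop : Filter.Tendsto f Filter.atTop Filter.atTop)
    (hg0 : Filter.Tendsto g Filter.atTop (nhds 0)) :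
    AsymptoticallyNormal (fun n k => if 0 ≤ k then (graphStirling (G n) k.toNat : ℝ) else 0) := by
  have h : ∀ n, ∃ (D : ℕ) (l : List ℝ), 1 ≤ D ∧ (∀ b ∈ l, 1 ≤ b) ∧ (∀ b ∈ l, b ≤ D) ∧
      (G n).chromaticNumber.toNat = D ∧ Fintype.card (V n) ≤ D + l.length ∧
      ∀ k, (graphStirling (G n) k : ℝ) = (Polynomial.X ^ D * stirlingPoly l).coeff k := fun n => by
    rcases hQT n with h | ⟨W, -, H, hH, hGH⟩
    exacts [exists_graphStirling_eq_coeff h fun _ => rfl, exists_graphStirling_eq_coeff hH hGH]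
  choose D l hD h1 h2 hchrom hcard hcoeff using h
  choose R hR _ hRl using fun n => exists_prod_X_add_C_eq_stirlingPoly (l n) fun b hb =>
    zero_lt_one.trans_le (h1 n b hb)
  let S : ℕ → Multiset ℝ := fun n => R n + Multiset.replicate (D n) 0
  have hS : ∀ n, ∀ r ∈ S n, 0 ≤ r := fun n r hr => by
    rcases Multiset.mem_add.1 hr with hr | hr
    exacts [hR n r hr, (Multiset.eq_of_mem_replicate hr).ge]
  have hprod : ∀ n, ((S n).map fun r => Polynomial.X + Polynomial.C r).prod =
      Polynomial.X ^ D n * stirlingPoly (l n) := fun n => by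
    simp [S, hRl, mul_comm]
  have hseq : (fun n k => if 0 ≤ k then (graphStirling (G n) k.toNat : ℝ) else 0) =
      fun n => coeffSeq ((S n).map fun r => Polynomial.X + Polynomial.C r).prod := by
    funext n k
    rw [coeffSeq, hprod, hcoeff]
  rw [hseq]
  refine asymptoticallyNormal_coeffSeq_prod S hS
    (tendsto_variance_of_coeff_le S hS fun δ hδ => ?_)
  obtain ⟨K, hK⟩ := exists_coeff_stirlingPoly_le_mul_eval_one hδ
  have hK0 : 0 < |K| + 1 := by positivity
  filter_upwards [hg0.eventually (gt_mem_nhds (inv_pos.2 hK0)), hftop.eventually_ge_atTop 1]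
    with n hgn hfn i
  rw [hprod]
  refine hK (l n) (D n) (hD n) (h1 n) (h2 n) ?_ i
  have hf0 : (0 : ℝ) < f n := by exact_mod_cast hfn
  rw [hg, hchrom, div_lt_iff₀ hf0, inv_mul_eq_div, lt_div_iff₀ hK0] at hgn
  have hle : (f n : ℝ) ≤ D n + (l n).length := by
    rw [hf]
    exact_mod_cast hcard n
  have := mul_le_mul_of_nonneg_right (le_abs_self K) (Nat.cast_nonneg (α := ℝ) (D n))
  linarith
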